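/- For every real number x ≥ e^{400}, the interval (x, x + 5·x^{1/5}·log x] contains a squarefree integer. -/

import Mathlib

/-- `u` is such that some multiple of `u ^ 2` lies in `(x, x + h]`. -/
def SqMul (x h : ℝ) (u : ℤ) : Prop :=
  ∃ m : ℤ, x < m * (u : ℝ) ^ 2 ∧ m * (u : ℝ) ^ 2 ≤ x + h

noncomputable def mm (x h : ℝ) (u : ℤ) : ℤ := ⌊(x + h) / (u : ℝ) ^ 2⌋

lemma mm_spec {x h M : ℝ} {u : ℤ} (hh : 0 ≤ h) (hM : 0 < M) (hu : M ≤ u) (hs : SqMul x h u) :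
    ∃ t : ℝ, (mm x h u : ℝ) = x / (u : ℝ) ^ 2 + t ∧ 0 ≤ t ∧ t ≤ h / (u : ℝ) ^ 2 ∧ t ≤ h / M ^ 2 := by
  obtain ⟨m, h1, h2⟩ := hs
  have hu0 : (0 : ℝ) < u := lt_of_lt_of_le hM hu
  have hu2 : (0 : ℝ) < (u : ℝ) ^ 2 := by positivity
  have h3 : m ≤ mm x h u := by
    unfold mm
    rw [Int.le_floor, le_div_iff₀ hu2]; exact h2
  have h3' : (m : ℝ) ≤ mm x h u := by exact_mod_cast h3
  have h4 : (mm x h u : ℝ) ≤ (x + h) / (u : ℝ) ^ 2 := Int.floor_le _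
  have h5 : x / (u : ℝ) ^ 2 ≤ m := by
    rw [div_le_iff₀ hu2]; exact h1.le
  have h6 : h / (u : ℝ) ^ 2 ≤ h / M ^ 2 := by gcongr
  rw [add_div] at h4
  exact ⟨mm x h u - x / (u : ℝ) ^ 2, by ring, by linarith, by linarith, by linarith⟩

/-- counting lemma -/
lemma count_bins (s : Finset ℤ) (k : ℕ) (lo L B : ℝ) (hL : 0 ≤ L) (hB : 0 < B)
    (hs : ∀ u ∈ s, lo ≤ (u : ℝ) ∧ (u : ℝ) ≤ lo + L)
    (hk : ∀ t ⊆ s, (∀ u ∈ t, ∀ v ∈ t, (v : ℝ) - u < B) → t.card ≤ k) :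
    (s.card : ℝ) ≤ k * (L / B + 1) := by
  classical
  set f : ℤ → ℕ := fun u => ⌊((u : ℝ) - lo) / B⌋₊ with hf
  have h1 : s.card ≤ k * (s.image f).card := by
    apply Finset.card_le_mul_card_image
    intro b _
    apply hk _ (Finset.filter_subset _ _)
    intro u hu v hv
    rw [Finset.mem_filter] at hu hv
    have hu1 := (hs u hu.1).1
    have hv1 := (hs v hv.1).1
    have e1 : (b : ℝ) ≤ ((u : ℝ) - lo) / B := by
      rw [← hu.2]; exact Nat.floor_le (div_nonneg (by linarith) hB.le)
    have e2 : ((v : ℝ) - lo) / B < b + 1 := by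
      rw [← hv.2]; exact Nat.lt_floor_add_one _
    rw [le_div_iff₀ hB] at e1
    rw [div_lt_iff₀ hB] at e2
    nlinarith
  have h2 : (s.image f).card ≤ ⌊L / B⌋₊ + 1 := by
    have : s.image f ⊆ Finset.range (⌊L / B⌋₊ + 1) := by
      intro b hb
      rw [Finset.mem_image] at hb
      obtain ⟨u, hu, rfl⟩ := hb
      rw [Finset.mem_range]
      apply Nat.lt_succ_of_le
      apply Nat.floor_le_floor
      have := (hs u hu).2
      gcongr
      linarith
    simpa using Finset.card_le_card this
  have h3 : ((⌊L / B⌋₊ : ℕ) : ℝ) ≤ L / B := Nat.floor_le (by positivity)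
  calc (s.card : ℝ) ≤ (k * (s.image f).card : ℕ) := by exact_mod_cast h1
    _ = k * ((s.image f).card : ℝ) := by push_cast; ring
    _ ≤ k * ((⌊L / B⌋₊ : ℝ) + 1) := by
        gcongr; exact_mod_cast h2
    _ ≤ k * (L / B + 1) := by gcongr

lemma count_bins_one (s : Finset ℤ) (lo L B : ℝ) (hL : 0 ≤ L) (hB : 0 < B)
    (hs : ∀ u ∈ s, lo ≤ (u : ℝ) ∧ (u : ℝ) ≤ lo + L)
    (hk : ∀ u ∈ s, ∀ v ∈ s, u < v → B ≤ (v : ℝ) - u) :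
    (s.card : ℝ) ≤ L / B + 1 := by
  have := count_bins s 1 lo L B hL hB hs (by
    intro t ht h
    rw [Finset.card_le_one]
    intro u hu v hv
    by_contra hne
    rcases lt_or_gt_of_ne hne with h' | h'
    · have := hk u (ht hu) v (ht hv) h'
      have := h u hu v hv
      linarith
    · have := hk v (ht hv) u (ht hu) h'
      have := h v hv u hu
      linarith)
  simpa using this

/-! real identities -/

lemma D_bounds {u a b M R : ℝ} (hM : 0 < M) (hu : M ≤ u) (ha : 0 < a) (hb : 0 < b)
    (hR : u + a + b ≤ R) :
    6 * a * b / R ^ 4 ≤ 1/u^2 - 1/(u+a)^2 - 1/(u+b)^2 + 1/(u+a+b)^2 ∧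
    1/u^2 - 1/(u+a)^2 - 1/(u+b)^2 + 1/(u+a+b)^2 ≤ 8 * a * b * R^2 / M ^ 6 := by
  have hu0 : 0 < u := lt_of_lt_of_le hM hu
  have hR0 : 0 < R := by linarith
  set p := u * (u+a+b) with hp
  set q := (u+a)*(u+b) with hq
  have key : 1/u^2 - 1/(u+a)^2 - 1/(u+b)^2 + 1/(u+a+b)^2
      = a*b*((2*u+a+b)^2*(p+q) - 2*p*q)/(p^2*q^2) := by
    rw [hp, hq]; field_simp; ring
  have hp0 : 0 < p := by positivity
  have hq0 : 0 < q := by positivity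
  have hpq : p ≤ q := by rw [hp, hq]; nlinarith [mul_pos ha hb]
  have hc : 4 * q ≤ (2*u+a+b)^2 := by rw [hq]; nlinarith [sq_nonneg (a-b)]
  have hqR : q ≤ R^2 := by rw [hq, sq]; apply mul_le_mul <;> linarith
  have hcR : (2*u+a+b)^2 ≤ 4*R^2 := by
    have : (2*u+a+b)^2 ≤ (2*R)^2 := by apply pow_le_pow_left₀ <;> linarith
    linarith
  have hpM : M^2 ≤ p := by rw [hp, sq]; apply mul_le_mul <;> linarith
  rw [key]
  constructor
  · rw [div_le_div_iff₀ (by positivity) (by positivity)]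
    have e1 : 6*p*q ≤ (2*u+a+b)^2*(p+q) - 2*p*q := by nlinarith
    have e2 : p*q ≤ R^4 := by
      calc p*q ≤ R^2*R^2 := by apply mul_le_mul <;> nlinarith
        _ = R^4 := by ring
    calc 6*a*b*(p^2*q^2) = (a*b*(6*p*q))*(p*q) := by ring
      _ ≤ (a*b*((2*u+a+b)^2*(p+q) - 2*p*q)) * R^4 := by
          have e3 : 0 ≤ (2*u+a+b)^2*(p+q) - 2*p*q := le_trans (by positivity) e1
          have e4 : 0 ≤ a*b*((2*u+a+b)^2*(p+q) - 2*p*q) := by positivity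
          gcongr
  · calc a*b*((2*u+a+b)^2*(p+q) - 2*p*q)/(p^2*q^2)
        ≤ a*b*(4*R^2*(q+q))/(p^2*q^2) := by
          gcongr
          have : (2*u+a+b)^2*(p+q) ≤ 4*R^2*(q+q) := by
            apply mul_le_mul hcR <;> first | positivity | linarith
          have : 0 ≤ p*q := by positivity
          nlinarith
      _ = 8*a*b*R^2/(p^2*q) := by field_simp; ring
      _ ≤ 8*a*b*R^2/((M^2)^2*M^2) := by
          gcongr; linarith
      _ = _ := by ring_nf

lemma K_bounds {u a b M R : ℝ} (hM : 0 < M) (hu : M ≤ u) (ha : 0 < a) (hb : a < b)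
    (hR : u + a + b ≤ R) :
    4 * a * b * (b^2-a^2) / R ^ 5 ≤
      (b-a)*(1/u^2 - 1/(u+a+b)^2) - (a+b)*(1/(u+a)^2 - 1/(u+b)^2) ∧
    (b-a)*(1/u^2 - 1/(u+a+b)^2) - (a+b)*(1/(u+a)^2 - 1/(u+b)^2) ≤
      4 * a * b * (b^2-a^2) / M ^ 5 := by
  have hu0 : 0 < u := lt_of_lt_of_le hM hu
  have hR0 : 0 < R := by linarith
  have hb0 : 0 < b := by linarith
  have hba : 0 < b^2-a^2 := by nlinarith
  set p := u * (u+a+b) with hp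
  set q := (u+a)*(u+b) with hq
  have key : (b-a)*(1/u^2 - 1/(u+a+b)^2) - (a+b)*(1/(u+a)^2 - 1/(u+b)^2)
      = a*b*(b^2-a^2)*((2*u+a+b)*(p+q))/(p^2*q^2) := by
    rw [hp, hq]; field_simp; ring
  have hp0 : 0 < p := by positivity
  have hq0 : 0 < q := by positivity
  have hpq : p ≤ q := by rw [hp, hq]; nlinarith [mul_pos ha hb0]
  set c := (2*u+a+b)/2 with hcdef
  have hc2 : 2*u+a+b = 2*c := by rw [hcdef]; ring
  have hc0 : 0 < c := by rw [hcdef]; positivity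
  have hc : q ≤ c^2 := by rw [hq, hcdef]; nlinarith [sq_nonneg (a-b)]
  have hcR : c ≤ R := by rw [hcdef]; linarith
  have hup : c * u ≤ p := by rw [hp, hcdef]; nlinarith
  have hqM : M^2 ≤ q := by rw [hq, sq]; apply mul_le_mul <;> linarith
  have hpM : M^2 ≤ p := by rw [hp, sq]; apply mul_le_mul <;> linarith
  rw [key, hc2]
  constructor
  · rw [div_le_div_iff₀ (by positivity) (by positivity)]
    have e2 : p*q^2 ≤ c * R^5 := by
      calc p*q^2 ≤ c^2*(c^2)^2 := by gcongr; linarith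
        _ = c * c^5 := by ring
        _ ≤ c*R^5 := by gcongr
    calc 4*a*b*(b^2-a^2)*(p^2*q^2) = (4*a*b*(b^2-a^2)*p)*(p*q^2) := by ring
      _ ≤ (4*a*b*(b^2-a^2)*p)*(c*R^5) := by gcongr
      _ = a*b*(b^2-a^2)*(2*c*(p+p))*R^5 := by ring
      _ ≤ _ := by gcongr
  · calc a*b*(b^2-a^2)*(2*c*(p+q))/(p^2*q^2)
        ≤ a*b*(b^2-a^2)*(2*c*(q+q))/(p^2*q^2) := by gcongr
      _ = 4*a*b*(b^2-a^2)*c/(p*p*q) := by field_simp; ring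
      _ ≤ 4*a*b*(b^2-a^2)*c/((c*u)*p*q) := by gcongr
      _ = 4*a*b*(b^2-a^2)/(u*p*q) := by field_simp
      _ ≤ 4*a*b*(b^2-a^2)/(M*M^2*M^2) := by gcongr
      _ = _ := by ring_nf

lemma G_diff {u a b R : ℝ} (hu : 0 < u) (ha : 0 < a) (hb : 0 < b) (hR : u + a + b ≤ R) :
    4 * b / R ^ 5 ≤ 1/(u^2*(u+a)^2) - 1/((u+b)^2*(u+b+a)^2) := by
  have hR0 : 0 < R := by linarith
  set p := u * (u+a) with hp
  set q := (u+b)*(u+b+a) with hq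
  have hp0 : 0 < p := by positivity
  have hq0 : 0 < q := by positivity
  set α := u + a/2 with hα
  set β := u + b + a/2 with hβ
  have hα0 : 0 < α := by positivity
  have hαβ : α ≤ β := by linarith
  have hβR : β ≤ R := by linarith
  have hpα : p ≤ α^2 := by rw [hp, hα]; nlinarith [sq_nonneg a]
  have hqβ : q ≤ β^2 := by rw [hq, hβ]; nlinarith [sq_nonneg a]
  have hqp : q - p = b*(α+β) := by rw [hp,hq,hα,hβ]; ring
  have hpq : p ≤ q := by
    have : 0 ≤ b*(α+β) := by positivity
    linarith
  have e : 1/(u^2*(u+a)^2) - 1/((u+b)^2*(u+b+a)^2) = b*(α+β)*(p+q)/(p^2*q^2) := by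
    rw [← hqp, hp, hq]; field_simp; ring
  rw [e]
  have hβ0 : 0 < β := by linarith
  have s1 : 2*α^2 ≤ (α+β)*β := by nlinarith
  calc 4*b/R^5 ≤ 4*b/β^5 := by gcongr
    _ ≤ b*(α+β)*(p+p)/(p^2*q^2) := by
      have e3 : b*(α+β)*(p+p)/(p^2*q^2) = 2*b*(α+β)/(p*q^2) := by field_simp; ring
      rw [e3, div_le_div_iff₀ (by positivity) (by positivity)]
      calc 4*b*(p*q^2) ≤ 4*b*(α^2*(β^2)^2) := by gcongr
        _ = 2*b*β^4*(2*α^2) := by ring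
        _ ≤ 2*b*β^4*((α+β)*β) := by gcongr
        _ = _ := by ring
    _ ≤ _ := by gcongr

lemma G_ident {u a : ℝ} (hu : 0 < u) (ha : 0 < a) :
    (2*u-a)*(1/u^2) - (2*u+3*a)*(1/(u+a)^2) = -(a^3*(1/(u^2*(u+a)^2))) := by
  field_simp; ring


structure Win (x h M : ℝ) (W : Finset ℤ) : Prop where
  hx : 0 < x
  hh : 0 < h
  hM : 4 * h ≤ M
  hM' : 1000 ≤ M
  hD : h * M ^ 2 ≤ x
  mem : ∀ u ∈ W, M < (u : ℝ) ∧ (u : ℝ) ≤ 1.030301 * M ∧ Odd u ∧ SqMul x h u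

lemma Win.even {x h M : ℝ} {W : Finset ℤ} (w : Win x h M W) {u v : ℤ} (hu : u ∈ W) (hv : v ∈ W) :
    Even (v - u) := (w.mem v hv).2.2.1.sub_odd (w.mem u hu).2.2.1

set_option maxHeartbeats 1000000 in
lemma Win.second {x h M : ℝ} {W : Finset ℤ} (w : Win x h M W) {u a b : ℤ} (ha : 2 ≤ a) (hb : 2 ≤ b)
    (h1 : u ∈ W) (h2 : u + a ∈ W) (h3 : u + b ∈ W) (h4 : u + a + b ∈ W) :
    0.99 * M ^ 4 ≤ 8.5 * x * a * b := by
  have hM0 : 0 < M := by linarith [w.hM']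
  have hx := w.hx
  have hh := w.hh
  obtain ⟨t1, e1, p1, -, q1⟩ := mm_spec hh.le hM0 (w.mem _ h1).1.le (w.mem _ h1).2.2.2
  obtain ⟨t2, e2, p2, -, q2⟩ := mm_spec hh.le hM0 (w.mem _ h2).1.le (w.mem _ h2).2.2.2
  obtain ⟨t3, e3, p3, -, q3⟩ := mm_spec hh.le hM0 (w.mem _ h3).1.le (w.mem _ h3).2.2.2
  obtain ⟨t4, e4, p4, -, q4⟩ := mm_spec hh.le hM0 (w.mem _ h4).1.le (w.mem _ h4).2.2.2
  have ha' : (2 : ℝ) ≤ a := by exact_mod_cast ha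
  have hb' : (2 : ℝ) ≤ b := by exact_mod_cast hb
  have hR := (w.mem _ h4).2.1
  push_cast at e1 e2 e3 e4 hR
  obtain ⟨l, r⟩ := D_bounds hM0 (w.mem _ h1).1.le (by linarith : (0 : ℝ) < a)
    (by linarith : (0 : ℝ) < b) hR
  set D := 1/(u:ℝ)^2 - 1/((u:ℝ)+a)^2 - 1/((u:ℝ)+b)^2 + 1/((u:ℝ)+a+b)^2 with hDdef
  have hsum : ((mm x h u - mm x h (u+a) - mm x h (u+b) + mm x h (u+a+b) : ℤ) : ℝ)
      = x * D + (t1 - t2 - t3 + t4) := by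
    push_cast; rw [e1, e2, e3, e4, hDdef]; ring
  have hsmall : h / M^2 ≤ 1/4000 := by
    rw [div_le_iff₀ (by positivity)]; nlinarith only [w.hM, w.hM']
  have hpos : 2 * (h / M^2) < x * D := by
    have : x * (6*a*b/(1.030301*M)^4) ≤ x * D := by gcongr
    refine lt_of_lt_of_le ?_ this
    rw [← mul_div_assoc, ← mul_div_assoc, div_lt_div_iff₀ (by positivity) (by positivity)]
    have hab : (4 : ℝ) ≤ a * b := by nlinarith only [ha', hb']
    calc 2 * h * (1.030301*M)^4 = 2*1.030301^4 * (h * M^2) * M^2 := by ring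
      _ ≤ 2*1.030301^4 * x * M^2 := by gcongr; exact w.hD
      _ < x * (6 * 4) * M^2 := by
          have : 0 < x * M^2 := by positivity
          nlinarith only [this]
      _ ≤ x * (6 * (a*b)) * M^2 := by gcongr
      _ = _ := by ring
  have hint : (1 : ℤ) ≤ mm x h u - mm x h (u+a) - mm x h (u+b) + mm x h (u+a+b) := by
    have : (0 : ℝ) < ((mm x h u - mm x h (u+a) - mm x h (u+b) + mm x h (u+a+b) : ℤ) : ℝ) := by
      rw [hsum]; linarith
    have : 0 < mm x h u - mm x h (u+a) - mm x h (u+b) + mm x h (u+a+b) := by exact_mod_cast this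
    omega
  have hint' : (1 : ℝ) ≤ ((mm x h u - mm x h (u+a) - mm x h (u+b) + mm x h (u+a+b) : ℤ) : ℝ) := by
    exact_mod_cast hint
  rw [hsum] at hint'
  have f1 : 0.99 ≤ x * D := by linarith
  have f2 : x * D ≤ x * (8*a*b*(1.030301*M)^2/M^6) := by gcongr
  have f3 : x * (8*a*b*(1.030301*M)^2/M^6) = (8*1.030301^2) * (x*a*b)/M^4 := by
    field_simp
  have f4 := f1.trans f2
  rw [f3, le_div_iff₀ (by positivity)] at f4
  have : 0 ≤ x * a * b := by positivity
  nlinarith only [this, f4]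

set_option maxHeartbeats 1000000 in
lemma Win.third {x h M : ℝ} {W : Finset ℤ} (w : Win x h M W) {u a b : ℤ} (ha : 2 ≤ a)
    (hb : a + 2 ≤ b)
    (h1 : u ∈ W) (h2 : u + a ∈ W) (h3 : u + b ∈ W) (h4 : u + a + b ∈ W) :
    0.98 * M ^ 5 ≤ 4 * x * a * b ^ 3 := by
  have hsec := w.second ha (by omega : 2 ≤ b) h1 h2 h3 h4
  have hM0 : 0 < M := by linarith [w.hM']
  have hx := w.hx
  have hh := w.hh
  obtain ⟨t1, e1, p1, -, q1⟩ := mm_spec hh.le hM0 (w.mem _ h1).1.le (w.mem _ h1).2.2.2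
  obtain ⟨t2, e2, p2, -, q2⟩ := mm_spec hh.le hM0 (w.mem _ h2).1.le (w.mem _ h2).2.2.2
  obtain ⟨t3, e3, p3, -, q3⟩ := mm_spec hh.le hM0 (w.mem _ h3).1.le (w.mem _ h3).2.2.2
  obtain ⟨t4, e4, p4, -, q4⟩ := mm_spec hh.le hM0 (w.mem _ h4).1.le (w.mem _ h4).2.2.2
  have ha' : (2 : ℝ) ≤ a := by exact_mod_cast ha
  have hb' : (a : ℝ) + 2 ≤ b := by exact_mod_cast hb
  have hR := (w.mem _ h4).2.1
  have hu1 := (w.mem _ h1).1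
  push_cast at e1 e2 e3 e4 hR
  obtain ⟨l, r⟩ := K_bounds hM0 hu1.le (by linarith : (0 : ℝ) < a)
    (by linarith : (a : ℝ) < b) hR
  set D := ((b:ℝ)-a)*(1/(u:ℝ)^2 - 1/((u:ℝ)+a+b)^2) - (a+b)*(1/((u:ℝ)+a)^2 - 1/((u:ℝ)+b)^2)
    with hDdef
  set Z : ℤ := (b-a) * (mm x h u - mm x h (u+a+b)) - (a+b)*(mm x h (u+a) - mm x h (u+b)) with hZ
  have hsum : (Z : ℝ) = x * D + ((b-a)*(t1 - t4) - (a+b)*(t2 - t3)) := by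
    rw [hZ]; push_cast; rw [e1, e2, e3, e4, hDdef]; ring
  set η := h / M^2 with hη
  have herr : |((b:ℝ)-a)*(t1 - t4) - (a+b)*(t2 - t3)| ≤ 2 * b * η := by
    have g1 : |t1 - t4| ≤ η := by rw [abs_le]; constructor <;> linarith
    have g2 : |t2 - t3| ≤ η := by rw [abs_le]; constructor <;> linarith
    calc _ ≤ |((b:ℝ)-a)*(t1 - t4)| + |((a:ℝ)+b)*(t2 - t3)| := abs_sub _ _
      _ = (b-a) * |t1-t4| + (a+b) * |t2-t3| := by
        rw [abs_mul, abs_mul, abs_of_nonneg (by linarith : (0:ℝ) ≤ b - a),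
          abs_of_nonneg (by linarith : (0:ℝ) ≤ a + b)]
      _ ≤ (b-a) * η + (a+b) * η := by
        have z1 : (0:ℝ) ≤ b - a := by linarith
        have z2 : (0:ℝ) ≤ a + b := by linarith
        gcongr
      _ = 2 * b * η := by ring
  have hηM : η ≤ 1/(4*M) := by
    rw [hη, div_le_div_iff₀ (by positivity) (by positivity)]; nlinarith only [w.hM, hM0]
  have hb0 : (0:ℝ) < b := by linarith
  have hbη : 2 * b * η ≤ 0.5 * b / M := by
    calc 2 * b * η ≤ 2 * b * (1/(4*M)) := by gcongr
      _ = _ := by field_simp; norm_num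
  have hbM : (b:ℝ) ≤ 0.030301 * M := by linarith
  have hbη' : 2 * b * η ≤ 0.02 := by
    refine hbη.trans ?_
    rw [div_le_iff₀ hM0]; linarith
  have hpos : 2 * b * η < x * D := by
    refine lt_of_le_of_lt hbη ?_
    have : x * (4*a*b*(b^2-a^2)/(1.030301*M)^5) ≤ x * D := by gcongr
    refine lt_of_lt_of_le ?_ this
    rw [← mul_div_assoc, div_lt_div_iff₀ (by positivity) (by positivity)]
    have hab : 2 * (b : ℝ) ≤ b^2-a^2 := by
      nlinarith only [mul_nonneg (by linarith : (0:ℝ) ≤ b - a - 2) (by linarith : (0:ℝ) ≤ a + b), ha']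
    have hxab : 0 ≤ x * a * b := by positivity
    calc 0.5 * b * (1.030301*M)^5 = (0.5*1.030301^5) * b * M * M^4 := by ring
      _ < (4 * 2 * 0.99/8.5) * b * M * M^4 := by
          gcongr
          norm_num
      _ = (4 * 2 /8.5) * b * M * (0.99 * M^4) := by ring
      _ ≤ (4 * 2 /8.5) * b * M * (8.5 * x * a * b) := by gcongr
      _ = x * (4 * a * b * (2 * b)) * M := by ring
      _ ≤ _ := by gcongr
  have habs := abs_le.mp herr
  have hint : (1 : ℤ) ≤ Z := by
    have : (0 : ℝ) < (Z : ℝ) := by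
      rw [hsum]; linarith
    have : 0 < Z := by exact_mod_cast this
    omega
  have hint' : (1 : ℝ) ≤ (Z : ℝ) := by exact_mod_cast hint
  rw [hsum] at hint'
  have f1 : 0.98 ≤ x * D := by linarith
  have f2 : x * D ≤ x * (4*a*b*(b^2-a^2)/M^5) := by gcongr
  have f3 : x * (4*a*b*(b^2-a^2)/M^5) ≤ x * (4*a*b*(b^2)/M^5) := by
    gcongr
    nlinarith only [ha']
  have f4 : x * (4*a*b*(b^2)/M^5) = 4 * x * a * b^3 / M^5 := by ring
  have f5 := (f1.trans f2).trans f3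
  rwa [f4, le_div_iff₀ (by positivity)] at f5

open Classical in
noncomputable def TT (W : Finset ℤ) (a : ℤ) : Finset ℤ :=
  W.filter (fun u => u + a ∈ W ∧ ∀ v ∈ W, u < v → u + a ≤ v)

lemma mem_TT {W : Finset ℤ} {a u : ℤ} :
    u ∈ TT W a ↔ u ∈ W ∧ u + a ∈ W ∧ ∀ v ∈ W, u < v → u + a ≤ v := by
  simp [TT]

lemma Win.T_spacing {x h M : ℝ} {W : Finset ℤ} (w : Win x h M W) {a u v : ℤ} (ha : 2 ≤ a)
    (hu : u ∈ TT W a) (hv : v ∈ TT W a) (huv : u < v) :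
    0.99 * M ^ 4 ≤ 8.5 * x * a * ((v:ℝ) - u) := by
  rw [mem_TT] at hu hv
  have h1 := hu.2.2 v hv.1 huv
  have := w.second (u := u) (a := a) (b := v - u) ha (by omega) hu.1 hu.2.1
    (by simpa using hv.1) (by convert hv.2.1 using 1; ring)
  push_cast at this
  exact this

lemma Win.T_three {x h M : ℝ} {W : Finset ℤ} (w : Win x h M W) {a : ℤ} (ha : 2 ≤ a) {B : ℝ}
    (hB : 4 * x * a * B ^ 3 ≤ 0.98 * M ^ 5) (t : Finset ℤ) (ht : t ⊆ TT W a)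
    (htB : ∀ u ∈ t, ∀ v ∈ t, (v : ℝ) - u < B) : t.card ≤ 2 := by
  have claim : ∀ u ∈ t, ∀ v ∈ t, u < v → v = u + a := by
    intro u hu v hv huv
    have hlt := htB u hu v hv
    have hu' := mem_TT.mp (ht hu)
    have hv' := mem_TT.mp (ht hv)
    have h1 := hu'.2.2 v hv'.1 huv
    by_contra hne
    have ev1 := w.even hu'.1 hv'.1
    have ev2 := w.even hu'.1 hu'.2.1
    have h2 : a + 2 ≤ v - u := by
      obtain ⟨r, hr⟩ := ev1
      obtain ⟨s, hs⟩ := ev2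
      omega
    have := w.third (u := u) (a := a) (b := v - u) ha h2 hu'.1 hu'.2.1
      (by simpa using hv'.1) (by convert hv'.2.1 using 1; ring)
    push_cast at this
    have hx := w.hx
    have ha' : (2 : ℝ) ≤ a := by exact_mod_cast ha
    have h3 : (0 : ℝ) ≤ (v : ℝ) - u := by
      have : (u : ℝ) < v := by exact_mod_cast huv
      linarith
    have h4 : ((v : ℝ) - u)^3 < B^3 := by gcongr
    have h5 : 4 * x * a * ((v : ℝ) - u)^3 < 4 * x * a * B^3 := by gcongr
    linarith
  by_contra hc
  push Not at hc
  obtain ⟨i, hi, j, hj, k, hk, hij, hik, hjk⟩ := Finset.two_lt_card.mp hc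
  have c1 := claim i hi j hj
  have c2 := claim j hj i hi
  have c3 := claim i hi k hk
  have c4 := claim k hk i hi
  have c5 := claim j hj k hk
  have c6 := claim k hk j hj
  omega

noncomputable def gg (x h : ℝ) (a u : ℤ) : ℤ := (2*u-a) * mm x h u - (2*u+3*a) * mm x h (u+a)

lemma gg_spec {x h M : ℝ} {u a : ℤ} (hh : 0 ≤ h) (hM : 0 < M) (hu : M ≤ u) (ha : 0 < a)
    (ha2 : a ≤ 2 * u) (hs1 : SqMul x h u) (hs2 : SqMul x h (u+a)) :
    |(gg x h a u : ℝ) + x * a^3 * (1/((u:ℝ)^2*((u:ℝ)+a)^2))| ≤ 2 * h / M := by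
  have ha' : (0 : ℝ) < a := by exact_mod_cast ha
  have hu0 : (0 : ℝ) < u := by linarith
  have hua : M ≤ ((u + a : ℤ) : ℝ) := by push_cast; linarith
  have ha2' : (a : ℝ) ≤ 2 * u := by exact_mod_cast ha2
  obtain ⟨t1, e1, p1, q1, -⟩ := mm_spec hh hM hu hs1
  obtain ⟨t2, e2, p2, q2, -⟩ := mm_spec hh hM hua hs2
  push_cast at e1 e2 q2
  have hg : (gg x h a u : ℝ) + x * a^3 * (1/((u:ℝ)^2*((u:ℝ)+a)^2))
      = (2*u-a)*t1 - (2*u+3*a)*t2 := by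
    have := G_ident hu0 ha'
    unfold gg
    push_cast
    rw [e1, e2]
    linear_combination x * this
  rw [hg]
  have b1 : (2*(u:ℝ)-a)*t1 ≤ 2*h/M := by
    calc (2*(u:ℝ)-a)*t1 ≤ (2*u) * (h/(u:ℝ)^2) := by gcongr; linarith
      _ = 2*h/u := by field_simp
      _ ≤ 2*h/M := by gcongr
  have b2 : (2*(u:ℝ)+3*a)*t2 ≤ 2*h/M := by
    calc (2*(u:ℝ)+3*a)*t2 ≤ (2*u+3*a) * (h/((u:ℝ)+a)^2) := by gcongr
      _ ≤ 2*h/u := by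
        rw [← mul_div_assoc, div_le_div_iff₀ (by positivity) (by positivity)]
        have : (2*(u:ℝ)+3*a)*u ≤ 2*(u+a)^2 := by nlinarith [mul_pos hu0 ha']
        nlinarith
      _ ≤ 2*h/M := by gcongr
  have c1 : 0 ≤ (2*(u:ℝ)-a)*t1 := mul_nonneg (by linarith) p1
  have c2 : 0 ≤ (2*(u:ℝ)+3*a)*t2 := by positivity
  rw [abs_le]; constructor <;> linarith

lemma Win.T_class {x h M : ℝ} {W : Finset ℤ} (w : Win x h M W) {a : ℤ} (ha : 2 ≤ a) {Q : ℝ}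
    (hQ0 : 0 ≤ Q)
    (hQ : ∀ t ⊆ TT W a, (∀ u ∈ t, ∀ v ∈ t, (v : ℝ) - u ≤ 1.162 * h * M^4 / (x * a^3)) →
      (t.card : ℝ) ≤ Q) :
    ((TT W a).card : ℝ) ≤ Q * (0.1126 * x * a^3 / M^4 + 2) := by
  classical
  have hM0 : 0 < M := by linarith [w.hM']
  have hx := w.hx
  have hh := w.hh
  have ha' : (2 : ℝ) ≤ a := by exact_mod_cast ha
  have hsp : ∀ u ∈ TT W a, |(gg x h a u : ℝ) + x * a^3 * (1/((u:ℝ)^2*((u:ℝ)+a)^2))| ≤ 2 * h / M := by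
    intro u hu
    rw [mem_TT] at hu
    have m1 := w.mem _ hu.1
    have m2 := w.mem _ hu.2.1
    apply gg_spec hh.le hM0 m1.1.le (by omega) _ m1.2.2.2 m2.2.2.2
    have h1 := m2.2.1
    have h2 := m1.1
    push_cast at h1
    have : (a : ℝ) ≤ 2 * u := by linarith
    exact_mod_cast this
  have h1 : (TT W a).card ≤ ⌊Q⌋₊ * ((TT W a).image (gg x h a)).card := by
    apply Finset.card_le_mul_card_image
    intro b _
    apply Nat.le_floor
    apply hQ _ (Finset.filter_subset _ _)
    intro u hu v hv
    rw [Finset.mem_filter] at hu hv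
    by_cases huv : u < v
    · have s1 := hsp u hu.1
      have s2 := hsp v hv.1
      rw [hu.2, abs_le] at s1
      rw [hv.2, abs_le] at s2
      have hv2 := (w.mem _ (mem_TT.mp hv.1).2.1).2.1
      have hu1 := (w.mem _ (mem_TT.mp hu.1).1).1
      push_cast at hv2
      have huv' : (u : ℝ) < v := by exact_mod_cast huv
      have g := G_diff (u := (u:ℝ)) (a := a) (b := (v:ℝ) - u) (R := 1.030301 * M) (by linarith)
        (by linarith) (by linarith) (by linarith)
      have e1 : (u:ℝ) + ((v:ℝ) - u) = v := by ring
      rw [e1] at g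
      have g2 : x * a^3 * (4 * ((v:ℝ)-u)/(1.030301*M)^5) ≤ x * a^3 *
        (1/((u:ℝ)^2*((u:ℝ)+a)^2) - 1/((v:ℝ)^2*((v:ℝ)+a)^2)) := by gcongr
      have g3 : x * a^3 * (4 * ((v:ℝ)-u)/(1.030301*M)^5) ≤ 4 * h / M := by
        refine g2.trans ?_
        rw [mul_sub]
        have : 4 * h / M = 2*h/M + 2*h/M := by ring
        linarith [s1.1, s1.2, s2.1, s2.2]
      rw [← mul_div_assoc, div_le_div_iff₀ (by positivity) hM0] at g3
      rw [le_div_iff₀ (by positivity)]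
      have g4 : (((v:ℝ)-u) * (x*a^3)) * (4 * M) ≤ (1.162 * h * M^4) * (4 * M) := by
        calc (((v:ℝ)-u) * (x*a^3)) * (4 * M) = x * a ^ 3 * (4 * (↑v - ↑u)) * M := by ring
          _ ≤ _ := g3
          _ = (1.030301^5) * (4 * h * M^5) := by ring
          _ ≤ 1.162 * (4 * h * M^5) := by gcongr; norm_num
          _ = _ := by ring
      exact le_of_mul_le_mul_right g4 (by positivity)
    · have : (v : ℝ) ≤ u := by exact_mod_cast not_lt.mp huv
      have : (0:ℝ) ≤ 1.162 * h * M^4 / (x * a^3) := by positivity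
      linarith
  have h2 : (((TT W a).image (gg x h a)).card : ℝ) ≤
      ((x * a^3 * (1/M^4) - x * a^3 * (1/(1.030301*M)^4)) + 4*h/M)/1 + 1 := by
    have hle : x * a^3 * (1/(1.030301*M)^4) ≤ x * a^3 * (1/M^4) := by gcongr; linarith
    apply count_bins_one _ (-(x * a^3 * (1/M^4)) - 2*h/M) _ 1
    · have : 0 ≤ 4*h/M := by positivity
      linarith
    · norm_num
    · intro c hc
      rw [Finset.mem_image] at hc
      obtain ⟨u, hu, rfl⟩ := hc
      have s := hsp u hu
      rw [abs_le] at s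
      have hu1 := (w.mem _ (mem_TT.mp hu).1).1
      have hu2 := (w.mem _ (mem_TT.mp hu).2.1).2.1
      push_cast at hu2
      have b1 : x * a^3 * (1/((u:ℝ)^2*((u:ℝ)+a)^2)) ≤ x * a^3 * (1/M^4) := by
        have : M^4 ≤ (u:ℝ)^2*((u:ℝ)+a)^2 := by
          calc M^4 = M^2*M^2 := by ring
            _ ≤ _ := by gcongr; linarith
        gcongr
      have b2 : x * a^3 * (1/(1.030301*M)^4) ≤ x * a^3 * (1/((u:ℝ)^2*((u:ℝ)+a)^2)) := by
        have : (u:ℝ)^2*((u:ℝ)+a)^2 ≤ (1.030301*M)^4 := by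
          calc _ ≤ (1.030301*M)^2*(1.030301*M)^2 := by gcongr <;> linarith
            _ = _ := by ring
        have : 0 < (u:ℝ) := by linarith
        gcongr
      have : 4 * h / M = 2*h/M + 2*h/M := by ring
      constructor <;> linarith [s.1, s.2]
    · intro c _ d _ hcd
      have : (c : ℝ) + 1 ≤ d := by exact_mod_cast hcd
      linarith
  have h3 : 4 * h / M ≤ 1 := by rw [div_le_one hM0]; exact w.hM
  have h4 : x * a^3 * (1/M^4) - x * a^3 * (1/(1.030301*M)^4) ≤ 0.1126 * x * a^3 / M^4 := by
    have e : x * a^3 * (1/M^4) - x * a^3 * (1/(1.030301*M)^4)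
      = (1 - 1/1.030301^4) * (x * a^3 / M^4) := by field_simp
    have e' : 0.1126 * x * a^3 / M^4 = 0.1126 * (x * a^3 / M^4) := by ring
    rw [e, e']
    gcongr
    norm_num
  calc ((TT W a).card : ℝ) ≤ ((⌊Q⌋₊ * ((TT W a).image (gg x h a)).card : ℕ) : ℝ) := by
        exact_mod_cast h1
    _ = (⌊Q⌋₊ : ℝ) * (((TT W a).image (gg x h a)).card : ℝ) := by push_cast; ring
    _ ≤ Q * (0.1126 * x * a^3 / M^4 + 2) := by
      gcongr
      · exact Nat.floor_le hQ0
      · rw [div_one] at h2; linarith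

lemma decomp (W : Finset ℤ) (lo L A : ℝ) (hL : 0 ≤ L) (hA : 0 < A)
    (hs : ∀ u ∈ W, lo ≤ (u : ℝ) ∧ (u : ℝ) ≤ lo + L) (hodd : ∀ u ∈ W, Odd u) :
    (W.card : ℝ) ≤ (L / A + 1) +
      ∑ k ∈ Finset.Icc 1 ⌊A / 2⌋₊, ((TT W (2 * (k : ℤ))).card : ℝ) := by
  classical
  set Big := W.filter (fun u => ∀ v ∈ W, u < v → A ≤ (v : ℝ) - u) with hBig
  have h1 : (Big.card : ℝ) ≤ L / A + 1 := by
    apply count_bins_one Big lo L A hL hA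
    · intro u hu; exact hs u (Finset.mem_filter.mp hu).1
    · intro u hu v hv huv
      exact (Finset.mem_filter.mp hu).2 v (Finset.mem_filter.mp hv).1 huv
  have h2 : W ⊆ Big ∪ (Finset.Icc 1 ⌊A / 2⌋₊).biUnion (fun k => TT W (2 * (k : ℤ))) := by
    intro u hu
    rw [Finset.mem_union]
    by_cases hb : u ∈ Big
    · exact Or.inl hb
    · right
      rw [hBig, Finset.mem_filter] at hb
      push Not at hb
      obtain ⟨v, hv, huv, hvA⟩ := hb hu
      have hne : (W.filter (fun v => u < v)).Nonempty := ⟨v, by simp [hv, huv]⟩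
      set w := (W.filter (fun v => u < v)).min' hne with hw
      have hwm := Finset.min'_mem _ hne
      rw [← hw, Finset.mem_filter] at hwm
      have hwle : ∀ v ∈ W, u < v → w ≤ v := by
        intro v hv huv
        exact Finset.min'_le _ _ (by simp [hv, huv])
      obtain ⟨r, hr⟩ := (hodd w hwm.1).sub_odd (hodd u hu)
      have hr0 : 0 < r := by have := hwm.2; omega
      rw [Finset.mem_biUnion]
      have hrr : ((r.toNat : ℕ) : ℤ) = r := Int.toNat_of_nonneg hr0.le
      refine ⟨r.toNat, ?_, ?_⟩
      · rw [Finset.mem_Icc]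
        refine ⟨by omega, ?_⟩
        apply Nat.le_floor
        have e1 : ((r.toNat : ℕ) : ℝ) = (r : ℝ) := by exact_mod_cast hrr
        rw [e1]
        have e2 : (w : ℝ) - u = r + r := by exact_mod_cast hr
        have e3 : (w : ℝ) ≤ v := by exact_mod_cast hwle v hv huv
        linarith
      · rw [hrr, mem_TT]
        have e : u + 2 * r = w := by omega
        rw [e]
        exact ⟨hu, hwm.1, hwle⟩
  have h3 := Finset.card_le_card h2
  have h4 := Finset.card_union_le Big ((Finset.Icc 1 ⌊A / 2⌋₊).biUnion (fun k => TT W (2 * (k : ℤ))))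
  have h5 : ((Finset.Icc 1 ⌊A / 2⌋₊).biUnion (fun k => TT W (2 * (k : ℤ)))).card ≤
    ∑ k ∈ Finset.Icc 1 ⌊A / 2⌋₊, (TT W (2 * (k : ℤ))).card := Finset.card_biUnion_le
  have h6 : W.card ≤ Big.card + ∑ k ∈ Finset.Icc 1 ⌊A / 2⌋₊, (TT W (2 * (k : ℤ))).card := by
    omega
  have h7 : (W.card : ℝ) ≤ Big.card + ∑ k ∈ Finset.Icc 1 ⌊A / 2⌋₊, ((TT W (2 * (k : ℤ))).card : ℝ) := by
    exact_mod_cast h6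
  linarith


lemma tail_sum (f φ : ℝ → ℝ) (K : ℝ) (N : ℕ) (hφ0 : ∀ t, K - 1/2 ≤ t → 0 ≤ φ t)
    (hφ : ∀ s t, K - 1/2 ≤ s → s ≤ t → φ t ≤ φ s)
    (hf : ∀ k : ℝ, K < k → f k ≤ φ (k - 1/2) - φ (k + 1/2)) :
    ∑ k ∈ (Finset.Icc 1 N).filter (fun k : ℕ => K < (k : ℝ)), f (k : ℝ) ≤ φ (K - 1/2) := by
  have main : ∑ k ∈ (Finset.Icc 1 N).filter (fun k : ℕ => K < (k : ℝ)), f (k : ℝ) ≤ φ (K - 1/2) ∧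
      (K < (N : ℝ) → ∑ k ∈ (Finset.Icc 1 N).filter (fun k : ℕ => K < (k : ℝ)), f (k : ℝ) ≤
        φ (K - 1/2) - φ (N + 1/2)) ∧
      ((N : ℝ) ≤ K → ∑ k ∈ (Finset.Icc 1 N).filter (fun k : ℕ => K < (k : ℝ)), f (k : ℝ) = 0) := by
    induction N with
    | zero =>
      simp only [Finset.Icc_eq_empty (by norm_num : ¬ (1 ≤ 0)), Finset.filter_empty,
        Finset.sum_empty]
      refine ⟨hφ0 _ le_rfl, fun h => ?_, fun _ => trivial⟩
      have := hφ (K - 1/2) (((0:ℕ):ℝ) + 1/2) le_rfl (by push_cast at h ⊢; linarith)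
      linarith
    | succ N ih =>
      have hins : Finset.Icc 1 (N+1) = insert (N+1) (Finset.Icc 1 N) := by
        ext k; simp only [Finset.mem_Icc, Finset.mem_insert]; omega
      rw [hins, Finset.filter_insert]
      by_cases hK : K < ((N + 1 : ℕ) : ℝ)
      · rw [if_pos hK, Finset.sum_insert (by simp)]
        have hf1 := hf _ hK
        push_cast at hf1 hK ⊢
        have e1 : (N:ℝ) + 1 - 1/2 = N + 1/2 := by ring
        rw [e1] at hf1
        have hpos := hφ0 ((N:ℝ) + 1 + 1/2) (by linarith)
        have : f ((N:ℝ)+1) + ∑ k ∈ (Finset.Icc 1 N).filter (fun k : ℕ => K < (k : ℝ)), f (k : ℝ)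
            ≤ φ (K - 1/2) - φ (N + 1 + 1/2) := by
          rcases lt_or_ge K (N : ℝ) with h | h
          · have := ih.2.1 h; linarith
          · rw [ih.2.2 h]
            have := hφ (K - 1/2) ((N:ℝ) + 1/2) le_rfl (by linarith)
            linarith
        refine ⟨by linarith, fun _ => this, fun h => by linarith⟩
      · rw [if_neg hK]
        push Not at hK
        push_cast at hK
        have h0 := ih.2.2 (by linarith)
        refine ⟨ih.1, fun h => ?_, fun _ => h0⟩
        push_cast at h
        linarith
  exact main.1

lemma tail_cube (K : ℝ) (hK : 1 ≤ K) (N : ℕ) :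
    ∑ k ∈ (Finset.Icc 1 N).filter (fun k : ℕ => K < (k : ℝ)), 1 / (k : ℝ)^3
      ≤ 1/2 * (1 / (K - 1/2)^2) := by
  apply tail_sum (fun k => 1 / k^3) (fun t => 1/2 * (1/t^2)) K N
  · intro t ht; positivity
  · intro s t hs hst
    have : 0 < s := by linarith
    gcongr
  · intro k hk
    have h1 : 0 < k - 1/2 := by linarith
    have h2 : 0 < k + 1/2 := by linarith
    have hk0 : 0 < k := by linarith
    have e : 1/2*(1/(k-1/2)^2) - 1/2*(1/(k+1/2)^2) = k / ((k-1/2)^2*(k+1/2)^2) := by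
      rw [← sub_eq_zero]
      generalize hp : k - 1/2 = p at *
      have hk : k = p + 1/2 := by linarith
      subst hk
      have h3 : p + 1/2 + 1/2 = p + 1 := by ring
      rw [h3] at h2 ⊢
      field_simp; ring
    rw [e, div_le_div_iff₀ (by positivity) (by positivity)]
    have : (k-1/2)^2*(k+1/2)^2 = (k^2-1/4)^2 := by ring
    rw [this]
    have : (k^2-1/4)^2 ≤ (k^2)^2 := by
      apply pow_le_pow_left₀ <;> nlinarith
    nlinarith

lemma tail_sq (K : ℝ) (hK : 1 ≤ K) (N : ℕ) :
    ∑ k ∈ (Finset.Icc 1 N).filter (fun k : ℕ => K < (k : ℝ)), 1 / (k : ℝ)^2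
      ≤ 1 / (K - 1/2) := by
  apply tail_sum (fun k => 1 / k^2) (fun t => (1/t)) K N
  · intro t ht
    have : 0 < t := by linarith
    positivity
  · intro s t hs hst
    have : 0 < s := by linarith
    gcongr
  · intro k hk
    have h1 : 0 < k - 1/2 := by linarith
    have h2 : 0 < k + 1/2 := by linarith
    have hk0 : 0 < k := by linarith
    have e : (1/(k-1/2)) - (1/(k+1/2)) = 1 / ((k-1/2)*(k+1/2)) := by
      rw [← sub_eq_zero]
      generalize hp : k - 1/2 = p at *
      have hk : k = p + 1/2 := by linarith
      subst hk
      have h3 : p + 1/2 + 1/2 = p + 1 := by ring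
      rw [h3] at h2 ⊢
      field_simp; ring
    rw [e]
    gcongr
    nlinarith

/-- splitting a sum at `K` -/
lemma split_sum (N : ℕ) (K c : ℝ) (hK : 0 ≤ K) (hc : 0 ≤ c) (F G : ℕ → ℝ)
    (h1 : ∀ k ∈ Finset.Icc 1 N, (k : ℝ) ≤ K → F k ≤ c)
    (h2 : ∀ k ∈ Finset.Icc 1 N, K < (k : ℝ) → F k ≤ G k) :
    ∑ k ∈ Finset.Icc 1 N, F k ≤ K * c +
      ∑ k ∈ (Finset.Icc 1 N).filter (fun k : ℕ => K < (k : ℝ)), G k := by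
  rw [← Finset.sum_filter_add_sum_filter_not (Finset.Icc 1 N) (fun k : ℕ => (k:ℝ) ≤ K)]
  apply add_le_add
  · calc _ ≤ ∑ k ∈ (Finset.Icc 1 N).filter (fun k : ℕ => (k:ℝ) ≤ K), c := by
          apply Finset.sum_le_sum
          intro k hk
          rw [Finset.mem_filter] at hk
          exact h1 k hk.1 hk.2
      _ = ((Finset.Icc 1 N).filter (fun k : ℕ => (k:ℝ) ≤ K)).card * c := by
          rw [Finset.sum_const, nsmul_eq_mul]
      _ ≤ K * c := by
          gcongr
          have : (Finset.Icc 1 N).filter (fun k : ℕ => (k:ℝ) ≤ K) ⊆ Finset.Icc 1 ⌊K⌋₊ := by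
            intro k hk
            simp only [Finset.mem_filter, Finset.mem_Icc] at hk ⊢
            exact ⟨hk.1.1, Nat.le_floor hk.2⟩
          have := Finset.card_le_card this
          rw [Nat.card_Icc] at this
          calc ((Finset.card _ : ℕ) : ℝ) ≤ (⌊K⌋₊ : ℝ) := by exact_mod_cast this
            _ ≤ K := Nat.floor_le hK
  · simp only [not_le]
    apply Finset.sum_le_sum
    intro k hk
    rw [Finset.mem_filter] at hk
    exact h2 k hk.1 hk.2

lemma sum_const_le (N : ℕ) (K A c : ℝ) (hA : (N : ℝ) ≤ A) (hc : 0 ≤ c) :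
    ∑ _k ∈ (Finset.Icc 1 N).filter (fun k : ℕ => K < (k : ℝ)), c ≤ A * c := by
  rw [Finset.sum_const, nsmul_eq_mul]
  gcongr
  refine le_trans ?_ hA
  have := Finset.card_filter_le (Finset.Icc 1 N) (fun k : ℕ => K < (k : ℝ))
  rw [Nat.card_Icc] at this
  exact_mod_cast this

lemma count_span (t : Finset ℤ) (k : ℕ) (L B : ℝ) (hL : 0 ≤ L) (hB : 0 < B)
    (hs : ∀ u ∈ t, ∀ v ∈ t, (v : ℝ) - u ≤ L)
    (hk : ∀ t' ⊆ t, (∀ u ∈ t', ∀ v ∈ t', (v : ℝ) - u < B) → t'.card ≤ k) :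
    (t.card : ℝ) ≤ k * (L / B + 1) := by
  rcases t.eq_empty_or_nonempty with rfl | hne
  · simp; positivity
  · apply count_bins t k ((t.min' hne : ℤ) : ℝ) L B hL hB _ hk
    intro u hu
    constructor
    · exact_mod_cast Finset.min'_le t u hu
    · have := hs _ (Finset.min'_mem t hne) u hu
      linarith

set_option maxHeartbeats 1000000 in
lemma windowII {Y h s : ℝ} {W : Finset ℤ} (hY : 0 < Y) (hs : 4.47 ≤ s)
    (w : Win (Y^5) h (Y * s^6) W) :
    (W.card : ℝ) ≤ 0.1294 * Y + 1 + 0.0334 * h / s^2 + 21.2 * (h * s^10 / Y) + s^6 := by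
  have hh := w.hh
  have hs0 : 0 < s := by linarith
  have hd := decomp W (Y*s^6) (0.030301 * (Y*s^6)) (s^6/4) (by positivity) (by positivity)
    (fun u hu => ⟨(w.mem u hu).1.le, by have := (w.mem u hu).2.1; linarith⟩)
    (fun u hu => (w.mem u hu).2.2.1)
  have hgap : 0.030301 * (Y*s^6) / (s^6/4) = 0.121204 * Y := by field_simp; norm_num
  rw [hgap] at hd
  have hN : ((⌊s^6/4/2⌋₊ : ℕ) : ℝ) ≤ s^6/8 := by
    refine (Nat.floor_le (by positivity)).trans (le_of_eq (by ring))
  have hs3 : 89 ≤ s^3 := by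
    calc (89:ℝ) ≤ 4.47^3 := by norm_num
      _ ≤ s^3 := by gcongr
  have hsp := split_sum ⌊s^6/4/2⌋₊ (s^3/8) (0.0619 * Y / s^3 + 2) (by positivity) (by positivity)
    (fun k => ((TT W (2 * (k : ℤ))).card : ℝ))
    (fun k => (0.2671 * h / s^8 + 0.00353 * Y / s^6 + 4) + (0.593 * h * s^16 / Y) * (1 / (k:ℝ)^3)) ?_ ?_
  · rw [Finset.sum_add_distrib, ← Finset.mul_sum] at hsp
    have t1 := sum_const_le ⌊s^6/4/2⌋₊ (s^3/8) (s^6/8) (0.2671 * h / s^8 + 0.00353 * Y / s^6 + 4) hN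
      (by positivity)
    have t2 := tail_cube (s^3/8) (by linarith) ⌊s^6/4/2⌋₊
    have t3 : 1/2 * (1 / (s^3/8 - 1/2)^2) ≤ 35.2 / s^6 := by
      have : 0.955 * (s^3/8) ≤ s^3/8 - 1/2 := by linarith
      calc 1/2 * (1 / (s^3/8 - 1/2)^2) ≤ 1/2 * (1/(0.955*(s^3/8))^2) := by gcongr
        _ = (32/0.955^2) / s^6 := by field_simp; norm_num
        _ ≤ _ := by gcongr; norm_num
    have t4 : (0.593 * h * s^16 / Y) *
        ∑ k ∈ (Finset.Icc 1 ⌊s^6/4/2⌋₊).filter (fun k : ℕ => s^3/8 < (k : ℝ)), 1 / (k : ℝ)^3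
        ≤ (0.593 * h * s^16 / Y) * (35.2 / s^6) := by
      gcongr; exact t2.trans t3
    have t5 : (0.593 * h * s^16 / Y) * (35.2 / s^6) = (0.593 * 35.2) * (h * s^10 / Y) := by
      field_simp
    have t6 : s^3/8 * (0.0619 * Y / s^3 + 2) = 0.0077375 * Y + s^3/4 := by field_simp; ring
    have t7 : s^6/8 * (0.2671 * h / s^8 + 0.00353 * Y / s^6 + 4) =
      0.0333875 * (h / s^2) + 0.00044125 * Y + s^6/2 := by field_simp; ring
    have t8 : s^3/4 ≤ s^6/2 := by
      have : s^6 = s^3*s^3 := by ring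
      nlinarith
    have t9 : 0 ≤ h * s^10 / Y := by positivity
    have t10 : 0 ≤ h / s^2 := by positivity
    have t11 : 0.0334 * h / s^2 = 0.0334 * (h / s^2) := by ring
    rw [t11]
    rw [t6] at hsp
    rw [t7] at t1
    rw [t5] at t4
    linarith
  · intro k hk hkK
    rw [Finset.mem_Icc] at hk
    have hk1 : (1:ℝ) ≤ k := by exact_mod_cast hk.1
    have := count_bins (TT W (2 * (k : ℤ))) 2 (Y*s^6) (0.030301 * (Y*s^6)) (0.98 * s^9)
      (by positivity) (by positivity)
      (fun u hu => by
        have := w.mem u (mem_TT.mp hu).1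
        exact ⟨this.1.le, by linarith [this.2.1]⟩)
      (fun t ht htB => w.T_three (by omega) (by
        push_cast
        calc 4 * Y^5 * (2 * (k:ℝ)) * (0.98*s^9)^3 ≤ 4 * Y^5 * (2 * (s^3/8)) * (0.98*s^9)^3 := by gcongr
          _ = 0.98^3 * (Y*s^6)^5 := by ring
          _ ≤ 0.98 * (Y*s^6)^5 := by gcongr; norm_num) t ht htB)
    refine this.trans ?_
    have e : ((2:ℕ):ℝ) * (0.030301 * (Y*s^6) / (0.98 * s^9) + 1) = (2*0.030301/0.98) * (Y / s^3) + 2 := by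
      push_cast; field_simp
    rw [e]
    have e' : 0.0619 * Y / s^3 = 0.0619 * (Y / s^3) := by ring
    have e'' : 0 ≤ Y / s^3 := by positivity
    rw [e']
    linarith
  · intro k hk hkK
    rw [Finset.mem_Icc] at hk
    have hk1 : (1:ℝ) ≤ k := by exact_mod_cast hk.1
    have hk2 : (k:ℝ) ≤ s^6/8 := le_trans (by exact_mod_cast hk.2) hN
    have hka : (((2 * (k:ℤ) : ℤ)) : ℝ) = 2 * k := by push_cast; ring
    have key := w.T_class (a := 2 * (k:ℤ)) (by omega)
      (Q := 2 * ((1.162 * h * (Y*s^6)^4 / (Y^5 * (2*(k:ℝ))^3)) / (0.98 * s^8) + 1)) (by positivity)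
      (fun t ht htB => by
        rw [hka] at htB
        have := count_span t 2 (1.162 * h * (Y*s^6)^4 / (Y^5 * (2*(k:ℝ))^3)) (0.98 * s^8)
          (by positivity) (by positivity) htB
          (fun t' ht' htB' => w.T_three (by omega) (by
            rw [hka]
            calc 4 * Y^5 * (2 * (k:ℝ)) * (0.98*s^8)^3 ≤ 4 * Y^5 * (2 * (s^6/8)) * (0.98*s^8)^3 := by gcongr
              _ = 0.98^3 * (Y*s^6)^5 := by ring
              _ ≤ 0.98 * (Y*s^6)^5 := by gcongr; norm_num) t' (ht'.trans ht) htB')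
        exact_mod_cast this)
    rw [hka] at key
    refine key.trans ?_
    have e : 2 * ((1.162 * h * (Y*s^6)^4 / (Y^5 * (2*(k:ℝ))^3)) / (0.98 * s^8) + 1) *
        (0.1126 * Y^5 * (2*(k:ℝ))^3 / (Y*s^6)^4 + 2) =
        (2*1.162*0.1126/0.98) * (h / s^8) + (2*0.1126*8) * (Y * k^3 / s^24) + 4
          + (4*1.162/(0.98*8)) * (h * s^16 / Y) * (1/(k:ℝ)^3) := by
      field_simp; ring
    rw [e]
    have e2 : Y * (k:ℝ)^3 / s^24 ≤ (1/512) * (Y / s^6) := by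
      calc Y * (k:ℝ)^3 / s^24 ≤ Y * (s^6/8)^3 / s^24 := by gcongr
        _ = _ := by field_simp; norm_num
    have e3 : (2*1.162*0.1126/0.98) * (h / s^8) ≤ 0.2671 * h / s^8 := by
      have e' : 0.2671 * h / s^8 = 0.2671 * (h / s^8) := by ring
      rw [e']; gcongr; norm_num
    have e4 : (2*0.1126*8) * (Y * k^3 / s^24) ≤ 0.00353 * Y / s^6 := by
      have : 0 ≤ Y / s^6 := by positivity
      have e' : 0.00353 * Y / s^6 = 0.00353 * (Y / s^6) := by ring
      rw [e']
      linarith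
    have e5 : (4*1.162/(0.98*8)) * (h * s^16 / Y) * (1/(k:ℝ)^3) ≤
        (0.593 * h * s^16 / Y) * (1/(k:ℝ)^3) := by
      have : 0.593 * h * s^16 / Y = 0.593 * (h * s^16 / Y) := by ring
      rw [this]
      gcongr
      norm_num
    linarith


set_option maxHeartbeats 1000000 in
lemma windowIII {V h M : ℝ} {W : Finset ℤ} (hV : 1000 ≤ V) (hM6 : 6 * V^6 ≤ M)
    (hM8 : 400 * M ≤ V^8) (hhV : 10000 * h ≤ V * V^4)
    (w : Win ((V^4)^5) h M W) :
    (W.card : ℝ) ≤ 0.1294 * V^4 + 1 + 0.0352 * (h * V^12 / M^2) := by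
  have hh := w.hh
  have hV0 : 0 < V := by linarith
  have hM0 : 0 < M := by linarith [w.hM']
  have hd := decomp W M (0.030301 * M) (M/(4*V^4)) (by positivity) (by positivity)
    (fun u hu => ⟨(w.mem u hu).1.le, by have := (w.mem u hu).2.1; linarith⟩)
    (fun u hu => (w.mem u hu).2.2.1)
  have hgap : 0.030301 * M / (M/(4*V^4)) = 0.121204 * V^4 := by field_simp; norm_num
  rw [hgap] at hd
  set N := ⌊M/(4*V^4)/2⌋₊ with hNdef
  have hN : (N : ℝ) ≤ M/(8*V^4) := by
    refine (Nat.floor_le (by positivity)).trans (le_of_eq (by field_simp; norm_num))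
  have hsp := split_sum N (V/2) (0.0013 * V^3 + 1) (by positivity) (by positivity)
    (fun k => ((TT W (2 * (k : ℤ))).card : ℝ))
    (fun k => (0.2809 * (h * V^16 / M^3) + 0.00177 * (V^8 / M) + 2) + (5 * h) * (1 / (k:ℝ)^2)) ?_ ?_
  · rw [Finset.sum_add_distrib, ← Finset.mul_sum] at hsp
    have t1 := sum_const_le N (V/2) (M/(8*V^4)) (0.2809 * (h * V^16 / M^3) + 0.00177 * (V^8 / M) + 2) hN
      (by positivity)
    have t2 := tail_sq (V/2) (by linarith) N
    have t3 : 1 / (V/2 - 1/2) ≤ 2.1 / V := by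
      rw [div_le_div_iff₀ (by linarith) hV0]; linarith
    have t4 : (5 * h) *
        ∑ k ∈ (Finset.Icc 1 N).filter (fun k : ℕ => V/2 < (k : ℝ)), 1 / (k : ℝ)^2
        ≤ (5 * h) * (2.1 / V) := by
      gcongr; exact t2.trans t3
    have t5 : (5 * h) * (2.1 / V) ≤ 0.00106 * V^4 := by
      rw [← mul_div_assoc, div_le_iff₀ hV0]
      linarith [pow_pos hV0 4]
    have t6 : V/2 * (0.0013 * V^3 + 1) ≤ 0.00065 * V^4 + 0.0001 * V^4 := by
      have : V * (1000^3) ≤ V * V^3 := by gcongr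
      have : 0 ≤ V * V^3 := by positivity
      have e : V^4 = V * V^3 := by ring
      rw [e]
      linarith
    have t7 : M/(8*V^4) * (0.2809 * (h * V^16 / M^3) + 0.00177 * (V^8 / M) + 2) =
      (0.2809/8) * (h * V^12 / M^2) + (0.00177/8) * V^4 + M / (4 * V^4) := by field_simp; ring
    have t8 : M / (4 * V^4) ≤ 0.000625 * V^4 := by
      rw [div_le_iff₀ (by positivity)]
      have : V^8 = V^4 * V^4 := by ring
      linarith
    have t9 : 0 ≤ h * V^12 / M^2 := by positivity
    have t10 : 0 < V^4 := by positivity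
    rw [t7] at t1
    linarith
  · intro k hk hkK
    rw [Finset.mem_Icc] at hk
    have hk1 : (1:ℝ) ≤ k := by exact_mod_cast hk.1
    have hka : (((2 * (k:ℤ) : ℤ)) : ℝ) = 2 * k := by push_cast; ring
    have := count_bins_one (TT W (2 * (k : ℤ))) M (0.030301 * M)
      (0.99 * M^4 / (8.5 * (V^4)^5 * (2 * k)))
      (by positivity) (by positivity)
      (fun u hu => by
        have := w.mem u (mem_TT.mp hu).1
        exact ⟨this.1.le, by linarith [this.2.1]⟩)
      (fun u hu v hv huv => by
        have := w.T_spacing (a := 2 * (k:ℤ)) (by omega) hu hv huv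
        rw [hka] at this
        rw [div_le_iff₀ (by positivity)]
        linarith)
    refine this.trans ?_
    have e : 0.030301 * M / (0.99 * M^4 / (8.5 * (V^4)^5 * (2 * k))) =
      (0.030301 * 8.5 * 2 / 0.99) * (V^20 * k / M^3) := by field_simp
    rw [e]
    have e2 : V^20 * k / M^3 ≤ V^20 * (V/2) / (6 * V^6)^3 := by gcongr
    have e3 : V^20 * (V/2) / (6 * V^6)^3 = (1/432) * V^3 := by field_simp; norm_num
    have e4 : 0 < V^3 := by positivity
    rw [e3] at e2
    linarith
  · intro k hk hkK
    rw [Finset.mem_Icc] at hk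
    have hk1 : (1:ℝ) ≤ k := by exact_mod_cast hk.1
    have hk2 : (k:ℝ) ≤ M/(8*V^4) := le_trans (by exact_mod_cast hk.2) hN
    have hka : (((2 * (k:ℤ) : ℤ)) : ℝ) = 2 * k := by push_cast; ring
    have key := w.T_class (a := 2 * (k:ℤ)) (by omega)
      (Q := (1.162 * h * M^4 / ((V^4)^5 * (2*(k:ℝ))^3)) / (0.99 * M^4 / (8.5 * (V^4)^5 * (2 * k))) + 1)
      (by positivity)
      (fun t ht htB => by
        rw [hka] at htB
        have := count_span t 1 (1.162 * h * M^4 / ((V^4)^5 * (2*(k:ℝ))^3))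
          (0.99 * M^4 / (8.5 * (V^4)^5 * (2 * k)))
          (by positivity) (by positivity) htB
          (fun t' ht' htB' => by
            rw [Finset.card_le_one]
            have aux : ∀ u ∈ t', ∀ v ∈ t', ¬ u < v := by
              intro u hu v hv huv
              have h1 := w.T_spacing (a := 2 * (k:ℤ)) (by omega) (ht (ht' hu)) (ht (ht' hv)) huv
              rw [hka] at h1
              have h2 := htB' u hu v hv
              rw [lt_div_iff₀ (by positivity)] at h2
              linarith
            intro u hu v hv
            have h1 := aux u hu v hv
            have h2 := aux v hv u hu
            omega)
        rw [Nat.cast_one, one_mul] at this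
        exact this)
    rw [hka] at key
    refine key.trans ?_
    have e : ((1.162 * h * M^4 / ((V^4)^5 * (2*(k:ℝ))^3)) / (0.99 * M^4 / (8.5 * (V^4)^5 * (2 * k))) + 1) *
        (0.1126 * (V^4)^5 * (2*(k:ℝ))^3 / M^4 + 2) =
        (1.162*8.5/0.99*0.1126*2) * (h * V^20 * k / M^4) + (0.1126*8) * (V^20 * k^3 / M^4) + 2
          + (1.162*8.5/0.99/2) * h * (1/(k:ℝ)^2) := by
      field_simp; ring
    rw [e]
    have e2 : V^20 * (k:ℝ)^3 / M^4 ≤ (1/512) * (V^8 / M) := by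
      calc V^20 * (k:ℝ)^3 / M^4 ≤ V^20 * (M/(8*V^4))^3 / M^4 := by gcongr
        _ = _ := by field_simp; norm_num
    have e3 : h * V^20 * k / M^4 ≤ (1/8) * (h * V^16 / M^3) := by
      calc h * V^20 * k / M^4 ≤ h * V^20 * (M/(8*V^4)) / M^4 := by gcongr
        _ = _ := by field_simp
    have e5 : (1.162*8.5/0.99/2) * h * (1/(k:ℝ)^2) ≤ (5 * h) * (1/(k:ℝ)^2) := by
      gcongr
      norm_num
    have p1 : 0 ≤ V^8 / M := by positivity
    have p2 : 0 ≤ h * V^16 / M^3 := by positivity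
    linarith

set_option maxHeartbeats 1000000 in
lemma windowIV {Y h k : ℝ} {W : Finset ℤ} (hY : 1 ≤ Y) (hk : 0 < k) (hh : 0 < h)
    (h1 : 20 * h ≤ Y^2 * k^3) (h2 : 8 * h * (Y^2 * k^3) < Y^5)
    (hM1 : 1 ≤ Y^2*k^3) (h3 : 2100 * h * (Y^5)^2 < (Y^2*k^3)^6)
    (mem : ∀ u ∈ W, Y^2*k^3 < (u : ℝ) ∧ (u : ℝ) ≤ 1.953125 * (Y^2*k^3) ∧ SqMul (Y^5) h u) :
    (W.card : ℝ) ≤ 1.02 * (Y / k) + 1 := by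
  have hY0 : 0 < Y := by linarith
  set M := Y^2*k^3 with hM
  have hM0 : 0 < M := by positivity
  have hlow : ∀ u ∈ W, ∀ v ∈ W, u < v → 0.96 * (Y * k^4) ≤ (v:ℝ) - u := by
    intro u hu v hv huv
    obtain ⟨a, rfl⟩ : ∃ a, v = u + a := ⟨v - u, by ring⟩
    have ha : 0 < a := by omega
    have ha' : (1:ℝ) ≤ a := by exact_mod_cast ha
    obtain ⟨mu1, mu2, mu3⟩ := mem u hu
    obtain ⟨mv1, mv2, mv3⟩ := mem _ hv
    have hv2 := mv2
    push_cast at hv2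
    have hu0 : (0:ℝ) < u := by linarith
    have g := gg_spec hh.le hM0 mu1.le ha (by
      have : (a:ℝ) ≤ 2 * u := by linarith
      exact_mod_cast this) mu3 mv3
    have h4 : 2 * h / M ≤ 0.1 := by rw [div_le_iff₀ hM0]; linarith
    push_cast
    have e0 : (u:ℝ) + a - u = a := by ring
    rw [e0]
    have hprod : M^4 ≤ (u:ℝ)^2*((u:ℝ)+a)^2 := by
      calc M^4 = M^2*M^2 := by ring
        _ ≤ _ := by gcongr; linarith
    by_cases hg : gg (Y^5) h a u = 0
    · exfalso
      rw [hg, Int.cast_zero, zero_add] at g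
      have g' := (abs_le.mp g).2
      -- product upper bound
      have hup : (u:ℝ)^2*((u:ℝ)+a)^2 ≤ 14.6 * M^4 := by
        calc (u:ℝ)^2*((u:ℝ)+a)^2 ≤ (1.953125*M)^2 * (1.953125*M)^2 := by gcongr
          _ = 1.953125^4 * M^4 := by ring
          _ ≤ _ := by gcongr; norm_num
      have g2 : Y^5 * a^3 * (1/(14.6*M^4)) ≤ 2 * h / M := by
        refine le_trans ?_ g'
        gcongr
      have g3 : Y^5 * a^3 ≤ 29.2 * h * M^3 := by
        rw [mul_one_div, div_le_div_iff₀ (by positivity) hM0] at g2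
        have : (Y^5 * a^3) * M ≤ (29.2 * h * M^3) * M := by linarith
        exact le_of_mul_le_mul_right this hM0
      -- first difference
      obtain ⟨t1, e1, p1, q1, r1⟩ := mm_spec hh.le hM0 mu1.le mu3
      obtain ⟨t2, e2, p2, q2, r2⟩ := mm_spec hh.le hM0 mv1.le mv3
      push_cast at e2
      set d := 1/(u:ℝ)^2 - 1/((u:ℝ)+a)^2 with hd
      have hd' : d = (a * (2 * u + a)) / ((u:ℝ)^2*((u:ℝ)+a)^2) := by
        rw [hd]; field_simp; ring
      have dlow : Y^5 * (2 * M / (14.6 * M^4)) ≤ Y^5 * d := by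
        rw [hd']
        have hau : 2 * M ≤ a * (2 * u + a) := by nlinarith
        gcongr
      have dup : d ≤ a * (2 * (1.953125*M)) / M^4 := by
        rw [hd']
        gcongr
        linarith
      have dup' : Y^5 * d ≤ 3.90625 * (Y^5 * a / M^3) := by
        calc Y^5 * d ≤ Y^5 * (a * (2 * (1.953125*M)) / M^4) := by gcongr
          _ = _ := by field_simp; norm_num
      have small : h / M^2 < Y^5 * (2 * M / (14.6 * M^4)) := by
        have : Y^5 * (2 * M / (14.6 * M^4)) = (Y^5 * (2/14.6)) / (M^3) := by field_simp
        rw [this, div_lt_div_iff₀ (by positivity) (by positivity)]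
        have := mul_lt_mul_of_pos_right h2 (by positivity : 0 < M^2)
        have hp : 0 < Y^5 * M^2 := by positivity
        nlinarith only [this, hp]
      have hsum : ((mm (Y^5) h u - mm (Y^5) h (u+a) : ℤ) : ℝ) = Y^5 * d + (t1 - t2) := by
        push_cast; rw [e1, e2, hd]; ring
      have hint : (1:ℤ) ≤ mm (Y^5) h u - mm (Y^5) h (u+a) := by
        have : (0:ℝ) < ((mm (Y^5) h u - mm (Y^5) h (u+a) : ℤ) : ℝ) := by
          rw [hsum]; linarith
        have : 0 < mm (Y^5) h u - mm (Y^5) h (u+a) := by exact_mod_cast this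
        omega
      have hint' : (1:ℝ) ≤ ((mm (Y^5) h u - mm (Y^5) h (u+a) : ℤ) : ℝ) := by exact_mod_cast hint
      rw [hsum] at hint'
      have hsm : h / M^2 ≤ 0.05 := by
        rw [div_le_iff₀ (by positivity)]; nlinarith only [h1, hM1]
      have hfin : 0.95 ≤ 3.90625 * (Y^5 * a / M^3) := by linarith
      rw [← mul_div_assoc, le_div_iff₀ (by positivity)] at hfin
      have hc : (0.95 * M^3)^3 ≤ (3.90625 * (Y^5 * a))^3 := by gcongr
      have hc2 : (3.90625 * (Y^5 * a))^3 ≤ 3.90625^3 * Y^10 * (29.2 * h * M^3) := by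
        calc (3.90625 * (Y^5 * a))^3 = 3.90625^3 * Y^10 * (Y^5 * a^3) := by ring
          _ ≤ _ := by gcongr
      have hc3 : M^6 * (0.95^3 * M^3) ≤ (2100 * h * (Y^5)^2) * (0.95^3 * M^3) := by
        have hp : 0 ≤ h * Y^10 * M^3 := by positivity
        calc M^6 * (0.95^3 * M^3) = (0.95 * M^3)^3 := by ring
          _ ≤ 3.90625^3 * Y^10 * (29.2 * h * M^3) := hc.trans hc2
          _ = (3.90625^3 * 29.2) * (h * Y^10 * M^3) := by ring
          _ ≤ (2100 * 0.95^3) * (h * Y^10 * M^3) := mul_le_mul_of_nonneg_right (by norm_num) hp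
          _ = _ := by ring
      have := le_of_mul_le_mul_right hc3 (by positivity)
      linarith
    · have hg1 : (1:ℝ) ≤ |(gg (Y^5) h a u : ℝ)| := by
        exact_mod_cast Int.one_le_abs hg
      have hpos : 0 ≤ Y^5 * (a:ℝ)^3 * (1/((u:ℝ)^2*((u:ℝ)+a)^2)) := by positivity
      have h5 : 0.9 ≤ Y^5 * (a:ℝ)^3 * (1/((u:ℝ)^2*((u:ℝ)+a)^2)) := by
        have := abs_sub_abs_le_abs_add (gg (Y^5) h a u : ℝ) (Y^5 * (a:ℝ)^3 * (1/((u:ℝ)^2*((u:ℝ)+a)^2)))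
        rw [abs_of_nonneg hpos] at this
        linarith
      have h6 : 0.9 ≤ Y^5 * (a:ℝ)^3 * (1/M^4) := h5.trans (by gcongr)
      rw [mul_one_div, le_div_iff₀ (by positivity)] at h6
      have h7 : (0.96 * (Y*k^4))^3 ≤ (a:ℝ)^3 := by
        have : Y^5 * (0.96 * (Y*k^4))^3 ≤ Y^5 * (a:ℝ)^3 := by
          refine le_trans ?_ h6
          rw [hM]
          have : Y^5 * (0.96 * (Y*k^4))^3 = 0.96^3 * (Y^2*k^3)^4 := by ring
          rw [this]
          gcongr
          norm_num
        exact le_of_mul_le_mul_left this (by positivity)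
      exact le_of_pow_le_pow_left₀ (by norm_num) (by linarith) h7
  have := count_bins_one W M (0.953125 * M) (0.96 * (Y*k^4)) (by positivity) (by positivity)
    (fun u hu => ⟨(mem u hu).1.le, by linarith [(mem u hu).2.1]⟩) hlow
  refine this.trans ?_
  have e : 0.953125 * M / (0.96 * (Y*k^4)) = (0.953125/0.96) * (Y/k) := by
    rw [hM]; field_simp
  rw [e]
  have : 0 < Y / k := by positivity
  linarith


open Classical in
noncomputable def cnt (p : ℤ → Prop) (P R : ℝ) : Finset ℤ := (Finset.Ioc ⌊P⌋ ⌊R⌋).filter p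

lemma mem_cnt {p : ℤ → Prop} {P R : ℝ} {u : ℤ} : u ∈ cnt p P R ↔ P < (u:ℝ) ∧ (u:ℝ) ≤ R ∧ p u := by
  simp only [cnt, Finset.mem_filter, Finset.mem_Ioc, Int.floor_lt, Int.le_floor, and_assoc]

lemma cnt_add (p : ℤ → Prop) (P Q R : ℝ) : (cnt p P R).card ≤ (cnt p P Q).card + (cnt p Q R).card := by
  classical
  refine le_trans (Finset.card_le_card ?_) (Finset.card_union_le _ _)
  intro u hu
  rw [Finset.mem_union]
  simp only [mem_cnt] at hu ⊢
  rcases le_or_gt (u:ℝ) Q with h | h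
  · exact Or.inl ⟨hu.1, h, hu.2.2⟩
  · exact Or.inr ⟨h, hu.2⟩

lemma cnt_mono (p : ℤ → Prop) {P Q R : ℝ} (h : Q ≤ R) :
    ((cnt p P Q).card : ℝ) ≤ ((cnt p P R).card : ℝ) := by
  apply Nat.cast_le.mpr
  apply Finset.card_le_card
  intro u hu
  simp only [mem_cnt] at hu ⊢
  exact ⟨hu.1, hu.2.1.trans h, hu.2.2⟩

lemma cnt_cover (p : ℤ → Prop) (P l : ℝ) (J : ℕ) (b : ℕ → ℝ)
    (hb : ∀ j < J, ((cnt p (P * l^j) (P * l^(j+1))).card : ℝ) ≤ b j) :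
    ((cnt p P (P * l^J)).card : ℝ) ≤ ∑ j ∈ Finset.range J, b j := by
  induction J with
  | zero =>
    simp [cnt]
  | succ J ih =>
    rw [Finset.sum_range_succ]
    have h1 := ih (fun j hj => hb j (by omega))
    have h2 := hb J (by omega)
    have h3 : ((cnt p P (P * l^(J+1))).card : ℝ) ≤ (cnt p P (P * l^J)).card +
      (cnt p (P * l^J) (P * l^(J+1))).card := by exact_mod_cast cnt_add p P (P * l^J) (P * l^(J+1))
    linarith

lemma exists_J (P T l : ℝ) (hP : 0 < P) (hPT : P ≤ T) (hl : 1 < l) :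
    ∃ J : ℕ, T ≤ P * l^J ∧ (∀ j < J, P * l^j < T) ∧
      (J : ℝ) * Real.log l ≤ Real.log T - Real.log P + Real.log l := by
  classical
  have hT : 0 < T := by linarith
  have hex : ∃ J : ℕ, T ≤ P * l^J := by
    obtain ⟨n, hn⟩ := pow_unbounded_of_one_lt (T / P) hl
    refine ⟨n, ?_⟩
    rw [div_lt_iff₀ hP] at hn
    linarith
  have hmin : ∀ j < Nat.find hex, P * l^j < T := fun j hj => not_le.mp (Nat.find_min hex hj)
  refine ⟨Nat.find hex, Nat.find_spec hex, hmin, ?_⟩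
  have hlog : 0 < Real.log l := Real.log_pos hl
  rcases Nat.eq_zero_or_pos (Nat.find hex) with h | h
  · rw [h]
    have := Real.log_le_log hP hPT
    push_cast; linarith
  · obtain ⟨m, hm⟩ : ∃ m, Nat.find hex = m + 1 := ⟨Nat.find hex - 1, by omega⟩
    have h1 := hmin m (by omega)
    have h2 := Real.log_lt_log (by positivity) h1
    rw [Real.log_mul hP.ne' (by positivity), Real.log_pow] at h2
    rw [hm]; push_cast; linarith

lemma geom_dec (r : ℝ) (hr0 : 0 < r) (hr : r < 1) (J : ℕ) :
    ∑ j ∈ Finset.range J, r^j ≤ 1/(1-r) := by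
  rw [geom_sum_eq hr.ne]
  rw [← neg_div_neg_eq]
  have : 0 < 1 - r := by linarith
  rw [neg_sub, neg_sub]
  gcongr
  have := pow_pos hr0 J
  linarith

lemma geom_inc (q : ℝ) (hq : 1 < q) (c B : ℝ) (hB : 0 ≤ B) (J : ℕ) (hc : ∀ j < J, c * q^j ≤ B) (hc0 : 0 ≤ c) :
    ∑ j ∈ Finset.range J, c * q^j ≤ B * (q/(q-1)) := by
  have hq1 : 0 < q - 1 := by linarith
  rcases J with _ | J
  · simp; positivity
  · rw [← Finset.mul_sum, geom_sum_eq hq.ne', ← mul_div_assoc, ← mul_div_assoc]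
    apply div_le_div_of_nonneg_right _ hq1.le
    have := hc J (by omega)
    calc c * (q^(J+1) - 1) ≤ c * q^(J+1) := by gcongr; linarith
      _ = (c * q^J) * q := by ring
      _ ≤ B * q := by gcongr

/-- all size hypotheses on the parameters -/
structure Par (V l : ℝ) : Prop where
  hl : 400 ≤ l
  hV : 4.8e8 ≤ V
  hVl : 3000 * l^2 ≤ V

def PP (V l : ℝ) (u : ℤ) : Prop := Odd u ∧ SqMul ((V^4)^5) (5 * V^4 * l) u

lemma partII {V l : ℝ} (p : Par V l) :
    ∃ J : ℕ, ((cnt (PP V l) (20 * V^4 * l) (6 * V^6)).card : ℝ) ≤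
        J * (0.1295 * V^4) + 0.1832 * (5 * V^4 * l) ∧
      (J : ℝ) * Real.log 1.030301 ≤ Real.log (6*V^6) - Real.log (20 * V^4 * l) + Real.log 1.030301 := by
  have hl := p.hl
  have hV := p.hV
  have hVl := p.hVl
  have hl0 : 0 < l := by linarith
  have hV0 : 0 < V := by linarith
  have hV2l : 3000 * l ≤ V^2 := by nlinarith
  obtain ⟨J, hJ1, hJ2, hJ3⟩ := exists_J (20 * V^4 * l) (6 * V^6) 1.030301 (by positivity)
    (by
      have : 20 * V^4 * l = V^4 * (20 * l) := by ring
      have : 6 * V^6 = V^4 * (6 * V^2) := by ring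
      rw [‹20 * V^4 * l = V^4 * (20 * l)›, this]
      exact mul_le_mul_of_nonneg_left (by linarith) (by positivity)) (by norm_num)
  refine ⟨J, ?_, hJ3⟩
  set c := (20 * l)^((1:ℝ)/6) with hc
  set r := Real.sqrt 1.01 with hr
  have hc0 : 0 < c := by positivity
  have hr0 : 0 < r := by positivity
  have hc6 : c^6 = 20 * l := by
    rw [hc, ← Real.rpow_natCast, ← Real.rpow_mul (by positivity)]; norm_num
  have hr2 : r^2 = 1.01 := Real.sq_sqrt (by norm_num)
  have hc2 : 20 ≤ c^2 := by
    apply le_of_pow_le_pow_left₀ (n := 3) (by norm_num) (by positivity)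
    rw [← pow_mul]; norm_num; rw [hc6]; linarith
  have hc447 : 4.47 ≤ c := by
    apply le_of_pow_le_pow_left₀ (n := 2) (by norm_num) (by positivity)
    refine le_trans (by norm_num) hc2
  have hr1 : 1 ≤ r := by
    apply le_of_pow_le_pow_left₀ (n := 2) (by norm_num) (by positivity)
    rw [hr2]; norm_num
  have hMj : ∀ j : ℕ, V^4 * (c * r^j)^6 = 20 * V^4 * l * 1.030301^j := by
    intro j
    have : (1.030301:ℝ) = (r^2)^3 := by rw [hr2]; norm_num
    rw [this, mul_pow, hc6]; ring
  have hs6 : ∀ j < J, (c * r^j)^6 ≤ 6 * V^2 := by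
    intro j hj
    have h1 := hJ2 j hj
    rw [← hMj] at h1
    have : V^4 * (c * r^j)^6 ≤ V^4 * (6 * V^2) := by
      refine h1.le.trans (le_of_eq (by ring))
    exact le_of_mul_le_mul_left this (by positivity)
  have hs10 : ∀ j < J, (c * r^j)^10 ≤ 3.3e-5 * V^4 := by
    intro j hj
    have h1 := hs6 j hj
    apply le_of_pow_le_pow_left₀ (n := 3) (by norm_num) (by positivity)
    calc ((c * r^j)^10)^3 = ((c * r^j)^6)^5 := by ring
      _ ≤ (6 * V^2)^5 := by gcongr
      _ = 7776 * V^10 := by ring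
      _ ≤ ((3.3e-5)^3 * 4.8e8^2) * V^10 := by gcongr; norm_num
      _ ≤ ((3.3e-5)^3 * V^2) * V^10 := by gcongr
      _ = _ := by ring
  have hcov := cnt_cover (PP V l) (20 * V^4 * l) 1.030301 J
    (fun j => 0.1295 * V^4 + 0.0334 * (5 * V^4 * l) / 20 * (1/1.01)^j + 21.2 * (5 * V^4 * l) / V^4 * (c^10 * (1.01^5)^j)) ?_
  · have hm := cnt_mono (PP V l) (P := 20 * V^4 * l) hJ1
    refine hm.trans (hcov.trans ?_)
    rw [Finset.sum_add_distrib, Finset.sum_add_distrib,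
      Finset.sum_const, Finset.card_range, nsmul_eq_mul, ← Finset.mul_sum, ← Finset.mul_sum]
    have g1 := geom_dec (1/1.01) (by norm_num) (by norm_num) J
    have g2 := geom_inc (1.01^5) (by norm_num) (c^10) (3.3e-5 * V^4) (by positivity) J (by
      intro j hj
      refine le_trans (le_of_eq ?_) (hs10 j hj)
      rw [← hr2]; ring) (by positivity)
    have g3 : 0.0334 * (5 * V^4 * l) / 20 * ∑ j ∈ Finset.range J, (1/1.01:ℝ)^j ≤
        0.0334 * (5 * V^4 * l) / 20 * (1/(1-1/1.01)) := by gcongr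
    have g4 : 21.2 * (5 * V^4 * l) / V^4 * ∑ j ∈ Finset.range J, c^10 * (1.01^5)^j ≤
        21.2 * (5 * V^4 * l) / V^4 * (3.3e-5 * V^4 * (1.01^5/(1.01^5-1))) := by gcongr
    have g5 : 21.2 * (5 * V^4 * l) / V^4 * (3.3e-5 * V^4 * (1.01^5/(1.01^5-1))) =
      (21.2 * 3.3e-5 * (1.01^5/(1.01^5-1))) * (5 * V^4 * l) := by field_simp
    rw [g5] at g4
    have g6 : 0.0334 * (5 * V^4 * l) / 20 * (1/(1-1/1.01)) = (0.0334 / 20 * (1/(1-1/1.01))) * (5 * V^4 * l) := by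
      ring
    rw [g6] at g3
    have hp : 0 < V^4 * l := by positivity
    norm_num at g3 g4 ⊢
    linarith
  · intro j hj
    have hz := hs6 j hj
    have hrj : 1 ≤ r^j := one_le_pow₀ hr1
    have hMlt := hJ2 j hj
    have h1j : (1:ℝ) ≤ 1.030301^j := one_le_pow₀ (by norm_num)
    have hwin : Win ((V^4)^5) (5 * V^4 * l) (V^4 * (c * r^j)^6)
        (cnt (PP V l) (20 * V^4 * l * 1.030301^j) (20 * V^4 * l * 1.030301^(j+1))) := by
      rw [hMj]
      refine ⟨by positivity, by positivity, ?_, ?_, ?_, ?_⟩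
      · calc 4 * (5 * V^4 * l) = 20 * V^4 * l * 1 := by ring
          _ ≤ _ := by gcongr
      · have : (1:ℝ) ≤ V^4 := one_le_pow₀ (by linarith)
        calc (1000:ℝ) ≤ 20 * 1 * 400 * 1 := by norm_num
          _ ≤ 20 * V^4 * l * 1.030301^j := by gcongr
      · calc 5 * V^4 * l * (20 * V^4 * l * 1.030301^j)^2 ≤ 5 * V^4 * l * (6 * V^6)^2 := by gcongr
          _ = (180 * l) * V^16 := by ring
          _ ≤ V^4 * V^16 := by
            gcongr
            have : V^4 = V^2 * V^2 := by ring
            nlinarith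
          _ = _ := by ring
      · intro u hu
        rw [mem_cnt] at hu
        refine ⟨hu.1, hu.2.1.trans (le_of_eq (by ring)), hu.2.2.1, hu.2.2.2⟩
    have hw := windowII (by positivity) (by nlinarith) hwin
    refine hw.trans ?_
    have e1 : 0.0334 * (5 * V^4 * l) / (c * r^j)^2 ≤ 0.0334 * (5 * V^4 * l) / 20 * (1/1.01)^j := by
      have : (c * r^j)^2 = c^2 * 1.01^j := by rw [← hr2]; ring
      rw [this, one_div_pow, div_mul_div_comm, mul_one]
      gcongr
    have e2 : 21.2 * (5 * V^4 * l * (c * r^j)^10 / V^4) = 21.2 * (5 * V^4 * l) / V^4 * (c^10 * (1.01^5)^j) := by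
      rw [← hr2]; ring
    have e3 : 1 + 6 * V^2 ≤ 0.0001 * V^4 := by
      have : V^4 = V^2 * V^2 := by ring
      nlinarith
    linarith


lemma partIII {V l : ℝ} (p : Par V l) :
    ∃ J : ℕ, ((cnt (PP V l) (6 * V^6) (V^8/l)).card : ℝ) ≤
        J * (0.1295 * V^4) + 0.017 * (5 * V^4 * l) ∧
      (J : ℝ) * Real.log 1.030301 ≤ Real.log (V^8/l) - Real.log (6 * V^6) + Real.log 1.030301 := by
  have hl := p.hl
  have hV := p.hV
  have hVl := p.hVl
  have hl0 : 0 < l := by linarith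
  have hV0 : 0 < V := by linarith
  have hVl1 : 1000000 * l ≤ V := by nlinarith
  have hV2l : 3000 * l ≤ V^2 := by nlinarith
  obtain ⟨J, hJ1, hJ2, hJ3⟩ := exists_J (6 * V^6) (V^8/l) 1.030301 (by positivity)
    (by
      rw [le_div_iff₀ hl0]
      have e1 : 6 * V^6 * l = V^6 * (6 * l) := by ring
      have e2 : V^8 = V^6 * V^2 := by ring
      rw [e1, e2]
      exact mul_le_mul_of_nonneg_left (by linarith) (by positivity)) (by norm_num)
  refine ⟨J, ?_, hJ3⟩
  have hcov := cnt_cover (PP V l) (6 * V^6) 1.030301 J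
    (fun j => 0.1295 * V^4 + 0.0352 / 36 * (5 * V^4 * l) * (1/1.030301^2)^j) ?_
  · have hm := cnt_mono (PP V l) (P := 6 * V^6) hJ1
    refine hm.trans (hcov.trans ?_)
    rw [Finset.sum_add_distrib,
      Finset.sum_const, Finset.card_range, nsmul_eq_mul, ← Finset.mul_sum]
    have g1 := geom_dec (1/1.030301^2) (by norm_num) (by norm_num) J
    have g3 : 0.0352 / 36 * (5 * V^4 * l) * ∑ j ∈ Finset.range J, (1/1.030301^2:ℝ)^j ≤
        0.0352 / 36 * (5 * V^4 * l) * (1/(1-1/1.030301^2)) := by gcongr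
    have hp : 0 < V^4 * l := by positivity
    norm_num at g3 ⊢
    linarith
  · intro j hj
    have hMlt := hJ2 j hj
    have h1j : (1:ℝ) ≤ 1.030301^j := one_le_pow₀ (by norm_num)
    have hMlow : 6 * V^6 ≤ 6 * V^6 * 1.030301^j := le_mul_of_one_le_right (by positivity) h1j
    have hwin : Win ((V^4)^5) (5 * V^4 * l) (6 * V^6 * 1.030301^j)
        (cnt (PP V l) (6 * V^6 * 1.030301^j) (6 * V^6 * 1.030301^(j+1))) := by
      refine ⟨by positivity, by positivity, ?_, ?_, ?_, ?_⟩
      · refine le_trans ?_ hMlow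
        have e1 : 4 * (5 * V^4 * l) = V^4 * (20 * l) := by ring
        have e2 : 6 * V^6 = V^4 * (6 * V^2) := by ring
        rw [e1, e2]
        exact mul_le_mul_of_nonneg_left (by linarith) (by positivity)
      · refine le_trans ?_ hMlow
        have : (1000:ℝ) ≤ V := by linarith
        have : (1:ℝ) ≤ V^5 := one_le_pow₀ (by linarith)
        have e : V^6 = V * V^5 := by ring
        rw [e]; nlinarith
      · calc 5 * V^4 * l * (6 * V^6 * 1.030301^j)^2 ≤ 5 * V^4 * l * (V^8/l)^2 := by gcongr
          _ = (5 / l) * V^20 := by field_simp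
          _ ≤ 1 * V^20 := by
            gcongr
            rw [div_le_one hl0]; linarith
          _ = _ := by ring
      · intro u hu
        rw [mem_cnt] at hu
        refine ⟨hu.1, hu.2.1.trans (le_of_eq (by ring)), hu.2.2.1, hu.2.2.2⟩
    have hw := windowIII (by linarith) hMlow (by
      rw [lt_div_iff₀ hl0] at hMlt
      have : 6 * V^6 * 1.030301^j * 400 ≤ 6 * V^6 * 1.030301^j * l := by gcongr
      linarith) (by
      have : 10000 * (5 * V^4 * l) = (50000 * l) * V^4 := by ring
      rw [this]
      exact mul_le_mul_of_nonneg_right (by linarith) (by positivity)) hwin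
    refine hw.trans ?_
    have e1 : 0.0352 * (5 * V^4 * l * V^12 / (6 * V^6 * 1.030301^j)^2) = 
        0.0352 / 36 * (5 * V^4 * l) * (1/1.030301^2)^j := by
      rw [one_div_pow, ← pow_mul, mul_pow, ← pow_mul, mul_comm 2 j]
      field_simp
      norm_num
    have e3 : 1 ≤ 0.0001 * V^4 := by
      have : V * (1:ℝ) ≤ V * V^3 := by
        gcongr
        exact one_le_pow₀ (by linarith)
      have e : V^4 = V * V^3 := by ring
      linarith
    linarith

lemma partIV {V l : ℝ} (p : Par V l) :
    ((cnt (PP V l) (V^8/l) (2 * V^10)).card : ℝ) ≤ 0.0195 * (5 * V^4 * l) := by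
  have hl := p.hl
  have hV := p.hV
  have hVl := p.hVl
  have hl0 : 0 < l := by linarith
  have hV0 : 0 < V := by linarith
  have hVl1 : 1000000 * l ≤ V := by nlinarith
  obtain ⟨J, hJ1, hJ2, hJ3⟩ := exists_J (V^8/l) (2 * V^10) 1.953125 (by positivity)
    (by
      rw [div_le_iff₀ hl0]
      calc V^8 = V^8 * 1 * 1 * 1 := by ring
        _ ≤ V^8 * 2 * V^2 * l := by
          gcongr
          · norm_num
          · exact one_le_pow₀ (by linarith)
          · linarith
        _ = _ := by ring) (by norm_num)
  set g := l^((1:ℝ)/3) with hg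
  have hg0 : 0 < g := by positivity
  have hg3 : g^3 = l := by
    rw [hg, ← Real.rpow_natCast, ← Real.rpow_mul (by positivity)]; norm_num
  have hg7 : 7.3 ≤ g := by
    apply le_of_pow_le_pow_left₀ (n := 3) (by norm_num) (by positivity)
    rw [hg3]; norm_num; linarith
  have hgl : 53.29 * g ≤ l := by
    rw [← hg3]
    have : 7.3^2 ≤ g^2 := by gcongr
    nlinarith
  have hMj : ∀ j : ℕ, (V^4)^2 * ((1/g) * 1.25^j)^3 = V^8/l * 1.953125^j := by
    intro j
    have : (1.953125:ℝ) = (1.25)^3 := by norm_num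
    rw [this, mul_pow, div_pow, hg3, ← pow_mul (1.25:ℝ) j 3, ← pow_mul (1.25:ℝ) 3 j, mul_comm 3 j]; ring
  have hcov := cnt_cover (PP V l) (V^8/l) 1.953125 J
    (fun j => 1.03 * V^4 * g * (1/1.25)^j) ?_
  · have hm := cnt_mono (PP V l) (P := V^8/l) hJ1
    refine hm.trans (hcov.trans ?_)
    rw [← Finset.mul_sum]
    have g1 := geom_dec (1/1.25) (by norm_num) (by norm_num) J
    have g3 : 1.03 * V^4 * g * ∑ j ∈ Finset.range J, (1/1.25:ℝ)^j ≤
        1.03 * V^4 * g * (1/(1-1/1.25)) := by gcongr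
    have g4 : V^4 * (53.29 * g) ≤ V^4 * l := by gcongr
    norm_num at g3 g4 ⊢
    have hp : 0 < V^4 * l := by positivity
    linarith
  · intro j hj
    have hMlt := hJ2 j hj
    have h1j : (1:ℝ) ≤ 1.953125^j := one_le_pow₀ (by norm_num)
    have hMlow : V^8/l ≤ V^8/l * 1.953125^j := le_mul_of_one_le_right (by positivity) h1j
    set k := (1/g) * 1.25^j with hk
    have hk0 : 0 < k := by positivity
    rw [← hMj] at hMlt hMlow
    have hV1 : (1:ℝ) ≤ V := by linarith
    have hlow2 : V^7 ≤ (V^4)^2 * k^3 := by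
      refine le_trans ?_ hMlow
      rw [le_div_iff₀ hl0]
      have : V^8 = V^7 * V := by ring
      rw [this]
      gcongr
      linarith
    have hw := windowIV (W := cnt (PP V l) (V^8/l * 1.953125^j) (V^8/l * 1.953125^(j+1)))
      (Y := V^4) (h := 5 * V^4 * l) (k := k) (one_le_pow₀ hV1) hk0 (by positivity)
      (by
        refine le_trans ?_ hlow2
        calc 20 * (5 * V^4 * l) = V^4 * (100 * l) * 1 := by ring
          _ ≤ V^4 * V * V^2 := by
            gcongr
            · linarith
            · exact one_le_pow₀ hV1
          _ = _ := by ring)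
      (by
        calc 8 * (5 * V^4 * l) * ((V^4)^2 * k^3) ≤ 8 * (5 * V^4 * l) * (2 * V^10) := by gcongr
          _ = V^14 * (80 * l) := by ring
          _ < V^14 * (V * V^5) := by
            have : 1 ≤ V^5 := one_le_pow₀ hV1
            exact mul_lt_mul_of_pos_left (by nlinarith) (by positivity)
          _ = _ := by ring)
      (by
        refine le_trans ?_ hlow2
        exact one_le_pow₀ hV1)
      (by
        refine lt_of_lt_of_le ?_ (pow_le_pow_left₀ (by positivity) hMlow 6)
        rw [div_pow, lt_div_iff₀ (by positivity)]
        calc 2100 * (5 * V^4 * l) * ((V^4)^5)^2 * l^6 = V^44 * (10500 * l^7) := by ring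
          _ < V^44 * (3000*l^2)^4 := by
            gcongr
            have : (3000*l^2)^4 = (81000000000000 * l) * l^7 := by ring
            rw [this]
            gcongr
            linarith
          _ ≤ V^44 * V^4 := by gcongr
          _ = _ := by ring)
      (by
        intro u hu
        rw [mem_cnt] at hu
        rw [hMj]
        exact ⟨hu.1, hu.2.1.trans (le_of_eq (by ring)), hu.2.2.2⟩)
    refine hw.trans ?_
    have e1 : V^4 / k = V^4 * g * (1/1.25)^j := by
      rw [hk, one_div_pow]; field_simp
    have hk3 : k^3 ≤ (V^2)^3 := by
      have : (V^4)^2 * k^3 ≤ (V^4)^2 * (V^2)^3 := by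
        refine hMlt.le.trans ?_
        calc 2 * V^10 ≤ V * V^10 := by gcongr; linarith
          _ = V^11 * 1 := by ring
          _ ≤ V^11 * V^3 := by gcongr; exact one_le_pow₀ hV1
          _ = _ := by ring
      exact le_of_mul_le_mul_left this (by positivity)
    have hk2 : k ≤ V^2 := le_of_pow_le_pow_left₀ (by norm_num) (by positivity) hk3
    have e2 : 100 ≤ V^4 / k := by
      rw [le_div_iff₀ hk0]
      have : V^4 = V^2 * V^2 := by ring
      rw [this]
      have h100 : 100 ≤ V^2 := by nlinarith
      exact mul_le_mul h100 hk2 hk0.le (by positivity)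
    rw [e1] at e2 ⊢
    linarith


lemma odd_tail (N : ℕ) (hN : 16 ≤ N) :
    ∑ k ∈ Finset.Ioc 16 N, (if Odd k then 1/(k:ℝ)^2 else 0) ≤ 1/32 := by
  have key : (Even N → ∑ k ∈ Finset.Ioc 16 N, (if Odd k then 1/(k:ℝ)^2 else 0) ≤ 1/32 - 1/(2*(N:ℝ))) ∧
      (Odd N → ∑ k ∈ Finset.Ioc 16 N, (if Odd k then 1/(k:ℝ)^2 else 0) ≤ 1/32 - 1/(2*((N:ℝ)+1))) := by
    induction N, hN using Nat.le_induction with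
    | base =>
      refine ⟨fun _ => by norm_num, fun h => ?_⟩
      exact absurd h (by decide)
    | succ N hN ih =>
      rw [Finset.sum_Ioc_succ_top hN]
      have hN' : (16:ℝ) ≤ N := by exact_mod_cast hN
      constructor
      · intro he
        have ho : Odd N := by
          rw [← Nat.not_even_iff_odd]
          intro h
          exact Nat.even_add_one.mp he h
        rw [if_neg (Nat.not_odd_iff_even.mpr he)]
        have := ih.2 ho
        push_cast
        linarith
      · intro ho
        have he : Even N := by
          rw [← Nat.not_odd_iff_even]
          intro h
          exact Nat.odd_add_one.mp ho h
        rw [if_pos ho]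
        have := ih.1 he
        push_cast
        have h2 : 1/((N:ℝ)+1)^2 ≤ 1/(2*(N:ℝ)) - 1/(2*((N:ℝ)+1+1)) := by
          have e : 1/(2*(N:ℝ)) - 1/(2*((N:ℝ)+1+1)) = 1/((N:ℝ)*(N+2)) := by
            field_simp; ring
          rw [e]
          gcongr
          nlinarith
        linarith
  have hp : (0:ℝ) ≤ 1/(2*(N:ℝ)) := by positivity
  have hp' : (0:ℝ) ≤ 1/(2*((N:ℝ)+1)) := by positivity
  rcases Nat.even_or_odd N with h | h
  · have := key.1 h; linarith
  · have := key.2 h; linarith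

lemma prime_sq_sum (N : ℕ) (hN : 16 ≤ N) :
    ∑ p ∈ (Finset.Ioc 0 N).filter Nat.Prime, 1/(p:ℝ)^2 ≤ 0.467 := by
  have h1 : (Finset.Ioc 0 N).filter Nat.Prime ⊆
      {2,3,5,7,11,13} ∪ (Finset.Ioc 16 N).filter Odd := by
    intro p hp
    rw [Finset.mem_filter, Finset.mem_Ioc] at hp
    rw [Finset.mem_union]
    rcases le_or_gt p 16 with h | h
    · left
      obtain ⟨⟨h0, -⟩, hp⟩ := hp
      interval_cases p <;> first | decide | (exfalso; revert hp; decide)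
    · right
      rw [Finset.mem_filter, Finset.mem_Ioc]
      exact ⟨⟨h, hp.1.2⟩, hp.2.odd_of_ne_two (by omega)⟩
  have h2 := odd_tail N hN
  rw [← Finset.sum_filter] at h2
  calc _ ≤ ∑ p ∈ {2,3,5,7,11,13} ∪ (Finset.Ioc 16 N).filter Odd, 1/(p:ℝ)^2 :=
        Finset.sum_le_sum_of_subset_of_nonneg h1 (fun _ _ _ => by positivity)
    _ ≤ ∑ p ∈ ({2,3,5,7,11,13} : Finset ℕ), 1/(p:ℝ)^2 + ∑ p ∈ (Finset.Ioc 16 N).filter Odd, 1/(p:ℝ)^2 := by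
        rw [← Finset.sum_union_inter]
        have : 0 ≤ ∑ p ∈ ({2,3,5,7,11,13} : Finset ℕ) ∩ (Finset.Ioc 16 N).filter Odd, 1/(p:ℝ)^2 :=
          Finset.sum_nonneg (fun _ _ => by positivity)
        linarith
    _ ≤ _ := by
        have : ∑ p ∈ ({2,3,5,7,11,13} : Finset ℕ), 1/(p:ℝ)^2 ≤ 0.43572 := by
          norm_num [Finset.sum_insert]
        linarith

lemma pi_bound (z : ℝ) (hz : 80 ≤ Real.log z) (hz0 : 0 < z) :
    (((Finset.Ioc 0 ⌊z⌋₊).filter Nat.Prime).card : ℝ) ≤ 0.0232 * z := by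
  classical
  have hth := Chebyshev.theta_le_log4_mul_x hz0.le
  unfold Chebyshev.theta at hth
  set S := (Finset.Ioc 0 ⌊z⌋₊).filter Nat.Prime with hS
  set t := Real.exp (3/4 * Real.log z) with ht
  have ht0 : 0 < t := Real.exp_pos _
  have h1 : ∀ p ∈ S, (1:ℝ) ≤ (if (p:ℝ) ≤ t then 1 else 0) + Real.log p / 60 := by
    intro p hp
    rw [hS, Finset.mem_filter, Finset.mem_Ioc] at hp
    have hp1 : (1:ℝ) ≤ p := by exact_mod_cast hp.1.1
    split_ifs with h
    · have := Real.log_nonneg hp1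
      have : 0 ≤ Real.log p / 60 := by positivity
      linarith
    · push Not at h
      have := Real.log_lt_log ht0 h
      rw [ht, Real.log_exp] at this
      linarith
  have h2 := Finset.sum_le_sum h1
  rw [Finset.sum_const, nsmul_eq_mul, mul_one, Finset.sum_add_distrib, ← Finset.sum_div,
    ← Finset.sum_filter, Finset.sum_const, nsmul_eq_mul, mul_one] at h2
  have h3 : ((S.filter (fun p : ℕ => (p:ℝ) ≤ t)).card : ℝ) ≤ t := by
    have : S.filter (fun p : ℕ => (p:ℝ) ≤ t) ⊆ Finset.Ioc 0 ⌊t⌋₊ := by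
      intro p hp
      rw [Finset.mem_filter, hS, Finset.mem_filter, Finset.mem_Ioc] at hp
      rw [Finset.mem_Ioc]
      exact ⟨hp.1.1.1, Nat.le_floor hp.2⟩
    have := Finset.card_le_card this
    rw [Nat.card_Ioc] at this
    calc ((S.filter (fun p : ℕ => (p:ℝ) ≤ t)).card : ℝ) ≤ (⌊t⌋₊ : ℝ) := by exact_mod_cast this
      _ ≤ t := Nat.floor_le ht0.le
  have h4 : t * 100000 ≤ z := by
    have e : z = t * Real.exp (1/4 * Real.log z) := by
      rw [ht, ← Real.exp_add, ← Real.exp_log hz0, Real.log_exp]; congr 1; ring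
    have : 100000 ≤ Real.exp (1/4 * Real.log z) := by
      have h20 : Real.exp 20 ≤ Real.exp (1/4 * Real.log z) := Real.exp_le_exp.mpr (by linarith)
      have : (2:ℝ)^20 ≤ Real.exp 20 := by
        rw [show (20:ℝ) = ((20:ℕ):ℝ) * 1 by norm_num, Real.exp_nat_mul]
        have := Real.exp_one_gt_d9
        gcongr
        linarith
      norm_num at this
      linarith
    calc t * 100000 ≤ t * Real.exp (1/4 * Real.log z) := by gcongr
      _ = z := e.symm
  have h5 : Real.log 4 ≤ 1.38632 := by
    have := Real.log_two_lt_d9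
    rw [show (4:ℝ) = 2^2 by norm_num, Real.log_pow]
    push_cast; linarith
  have h6 : Real.log 4 * z ≤ 1.38632 * z := by gcongr
  linarith

lemma total {V l : ℝ} (p : Par V l) (hVexp : Real.log V = l / 20) :
    ((cnt (PP V l) (20 * V^4 * l) (2 * V^10)).card : ℝ) ≤ 0.395 * (5 * V^4 * l) := by
  have hl := p.hl
  have hV := p.hV
  have hl0 : 0 < l := by linarith
  have hV0 : 0 < V := by linarith
  obtain ⟨J2, a2, b2⟩ := partII p
  obtain ⟨J3, a3, b3⟩ := partIII p
  have a4 := partIV p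
  have s1 : ((cnt (PP V l) (20 * V^4 * l) (2 * V^10)).card : ℝ) ≤
    (cnt (PP V l) (20 * V^4 * l) (6 * V^6)).card + (cnt (PP V l) (6 * V^6) (2 * V^10)).card := by
    exact_mod_cast cnt_add _ _ _ _
  have s2 : ((cnt (PP V l) (6 * V^6) (2 * V^10)).card : ℝ) ≤
    (cnt (PP V l) (6 * V^6) (V^8/l)).card + (cnt (PP V l) (V^8/l) (2 * V^10)).card := by
    exact_mod_cast cnt_add _ _ _ _
  have hlog : 0.0297 ≤ Real.log 1.030301 := by
    have := Real.one_sub_inv_le_log_of_pos (by norm_num : (0:ℝ) < 1.01)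
    rw [show (1.030301:ℝ) = 1.01^3 by norm_num, Real.log_pow]
    push_cast
    norm_num at this ⊢
    linarith
  have hlog2 : Real.log 1.030301 ≤ 0.5 := by
    have := Real.log_le_sub_one_of_pos (by norm_num : (0:ℝ) < 1.030301)
    linarith
  have c1 : Real.log (V^8/l) = 8 * Real.log V - Real.log l := by
    rw [Real.log_div (by positivity) (by positivity), Real.log_pow]; push_cast; ring
  have c2 : Real.log (20*V^4*l) = Real.log 20 + 4 * Real.log V + Real.log l := by
    rw [Real.log_mul (by positivity) (by positivity), Real.log_mul (by positivity) (by positivity),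
      Real.log_pow]; push_cast; ring
  have c3 : 0 ≤ Real.log l := Real.log_nonneg (by linarith)
  have c4 : 1 ≤ Real.log 20 := by
    rw [Real.le_log_iff_exp_le (by norm_num)]
    have := Real.exp_one_lt_d9
    linarith
  have hJ : ((J2:ℝ) + J3) * 0.0297 ≤ l / 5 := by
    have : ((J2:ℝ) + J3) * 0.0297 ≤ ((J2:ℝ) + J3) * Real.log 1.030301 := by gcongr
    rw [c1] at b3
    rw [c2] at b2
    linarith
  have hJ2 : ((J2:ℝ) + J3) * 0.0297 * V^4 ≤ l / 5 * V^4 := by gcongr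
  have hp : 0 < V^4 * l := by positivity
  linarith

theorem main_contra {V l : ℝ} (p : Par V l) (hVexp : Real.log V = l / 20) :
    ∃ n : ℕ, 0 < n ∧ (V^4)^5 < (n : ℝ) ∧ (n : ℝ) ≤ (V^4)^5 + 5 * V^4 * l ∧ Squarefree n := by
  classical
  by_contra hcon
  push Not at hcon
  have hl := p.hl
  have hV := p.hV
  have hVl := p.hVl
  have hl0 : 0 < l := by linarith
  have hV0 : 0 < V := by linarith
  set x := (V^4)^5 with hx
  set h := 5 * V^4 * l with hh
  set z := 20 * V^4 * l with hz
  have hx0 : 0 < x := by positivity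
  have hh0 : 0 < h := by positivity
  have hz0 : 0 < z := by positivity
  have hzh : z = 4 * h := by rw [hz, hh]; ring
  have hV4 : 1000 ≤ V^4 := by
    calc (1000:ℝ) ≤ 1000^4 := by norm_num
      _ ≤ V^4 := by gcongr; linarith
  have hh1000 : 1000000 ≤ h := by
    rw [hh]; nlinarith
  set I := Finset.Ioc ⌊x⌋ ⌊x+h⌋ with hI
  have memI : ∀ n : ℤ, n ∈ I ↔ x < n ∧ (n:ℝ) ≤ x + h := by
    intro n
    rw [hI, Finset.mem_Ioc, Int.floor_lt, Int.le_floor]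
  have hIcard : h - 1 ≤ (I.card : ℝ) := by
    rw [hI, Int.card_Ioc]
    have h1 : ((⌊x+h⌋ - ⌊x⌋ : ℤ) : ℝ) ≤ ((⌊x+h⌋ - ⌊x⌋).toNat : ℝ) := by
      exact_mod_cast Int.self_le_toNat _
    push_cast at h1
    have := Int.lt_floor_add_one (x+h)
    have := Int.floor_le x
    linarith
  have hp : ∀ n ∈ I, ∃ q : ℕ, q.Prime ∧ ((q:ℤ)^2 ∣ n) := by
    intro n hn
    rw [memI] at hn
    have hn0 : 0 < n := by
      have : (0:ℝ) < n := by linarith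
      exact_mod_cast this
    obtain ⟨m, rfl⟩ := Int.eq_ofNat_of_zero_le hn0.le
    have := hcon m (by exact_mod_cast hn0) (by exact_mod_cast hn.1) (by exact_mod_cast hn.2)
    rw [Nat.squarefree_iff_prime_squarefree] at this
    push Not at this
    obtain ⟨q, hq, hd⟩ := this
    refine ⟨q, hq, ?_⟩
    have hd' : q^2 ∣ m := by rw [sq]; exact hd
    exact_mod_cast hd'
  set S := (Finset.Ioc 0 ⌊z⌋₊).filter Nat.Prime with hS
  set I2 := I.filter (fun n => ∃ q : ℕ, q.Prime ∧ z < q ∧ ((q:ℤ)^2 ∣ n)) with hI2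
  have hsub : I ⊆ S.biUnion (fun q => I.filter (fun n => (q:ℤ)^2 ∣ n)) ∪ I2 := by
    intro n hn
    obtain ⟨q, hq, hd⟩ := hp n hn
    rw [Finset.mem_union]
    rcases le_or_gt (q:ℝ) z with hqz | hqz
    · left
      rw [Finset.mem_biUnion]
      refine ⟨q, ?_, by rw [Finset.mem_filter]; exact ⟨hn, hd⟩⟩
      rw [hS, Finset.mem_filter, Finset.mem_Ioc]
      exact ⟨⟨hq.pos, Nat.le_floor hqz⟩, hq⟩
    · right
      rw [hI2, Finset.mem_filter]
      exact ⟨hn, q, hq, hqz, hd⟩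
  have hspace : ∀ q : ℕ, 0 < q → ∀ u v : ℤ, (q:ℤ)^2 ∣ u → (q:ℤ)^2 ∣ v → u < v → (q:ℝ)^2 ≤ (v:ℝ) - u := by
    intro q hq u v hu hv huv
    have h1 : (q:ℤ)^2 ≤ v - u := Int.le_of_dvd (by omega) (dvd_sub hv hu)
    exact_mod_cast h1
  have hsmall : ∀ q ∈ S, ((I.filter (fun n => (q:ℤ)^2 ∣ n)).card : ℝ) ≤ h * (1/(q:ℝ)^2) + 1 := by
    intro q hq
    rw [hS, Finset.mem_filter, Finset.mem_Ioc] at hq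
    have hq0 : (0:ℝ) < q := by exact_mod_cast hq.1.1
    rw [mul_one_div]
    apply count_bins_one _ x h ((q:ℝ)^2) hh0.le (by positivity)
    · intro u hu
      rw [Finset.mem_filter, memI] at hu
      exact ⟨hu.1.1.le, hu.1.2⟩
    · intro u hu v hv huv
      rw [Finset.mem_filter] at hu hv
      exact hspace q hq.1.1 u v hu.2 hv.2 huv
  have hI2card : (I2.card : ℝ) ≤ ((cnt (PP V l) z (2 * V^10)).card : ℝ) := by
    apply Nat.cast_le.mpr
    have hch : ∀ n : ℤ, ∃ q : ℕ, n ∈ I2 → (q.Prime ∧ z < q ∧ ((q:ℤ)^2 ∣ n)) := by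
      intro n
      by_cases hn : n ∈ I2
      · rw [hI2, Finset.mem_filter] at hn
        obtain ⟨q, hq⟩ := hn.2
        exact ⟨q, fun _ => hq⟩
      · exact ⟨0, fun h => absurd h hn⟩
    choose f hf using hch
    apply Finset.card_le_card_of_injOn (fun n => ((f n : ℕ) : ℤ))
    · intro n hn
      have hn' : n ∈ I2 := hn
      obtain ⟨f1, f2, f3⟩ := hf n hn'
      have hnI := (memI n).mp (Finset.mem_filter.mp hn').1
      obtain ⟨m, hm⟩ := f3
      have hmR : (n:ℝ) = m * ((f n : ℕ):ℝ)^2 := by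
        have : (n:ℝ) = (((f n : ℕ):ℤ)^2 * m : ℤ) := by exact_mod_cast congrArg (Int.cast (R := ℝ)) hm
        rw [this]; push_cast; ring
      simp only [Finset.mem_coe, mem_cnt]
      refine ⟨by exact_mod_cast f2, ?_, ?_, ?_⟩
      · apply le_of_pow_le_pow_left₀ (n := 2) (by norm_num) (by positivity)
        have hn0 : 0 < n := by
          have : (0:ℝ) < n := by linarith
          exact_mod_cast this
        have hle : ((f n : ℕ):ℤ)^2 ≤ n := Int.le_of_dvd hn0 ⟨m, hm⟩
        have hle' : (((f n : ℕ):ℤ):ℝ)^2 ≤ n := by exact_mod_cast hle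
        refine hle'.trans (hnI.2.trans ?_)
        have e : (2 * V^10)^2 = 4 * x := by rw [hx]; ring
        rw [e]
        have : h ≤ x := by
          rw [hh, hx]
          calc 5 * V^4 * l = (5 * l) * V^4 := by ring
            _ ≤ V^16 * V^4 := by
              gcongr
              have h1 : V^1 ≤ V^16 := pow_le_pow_right₀ (by linarith) (by norm_num)
              nlinarith
            _ = _ := by ring
        linarith
      · have : Odd (f n) := f1.odd_of_ne_two (by
          intro h2
          rw [h2] at f2
          push_cast at f2
          linarith)
        exact_mod_cast this
      · refine ⟨m, ?_, ?_⟩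
        · have := hnI.1
          rw [hmR] at this
          exact_mod_cast this
        · have := hnI.2
          rw [hmR] at this
          exact_mod_cast this
    · intro n hn m hm hnm
      have hn' : n ∈ I2 := hn
      have hm' : m ∈ I2 := hm
      dsimp only at hnm
      have hfe : f n = f m := by exact_mod_cast hnm
      obtain ⟨f1, f2, f3⟩ := hf n hn'
      obtain ⟨g1, g2, g3⟩ := hf m hm'
      rw [← hfe] at g3
      have hnI := (memI n).mp (Finset.mem_filter.mp hn').1
      have hmI := (memI m).mp (Finset.mem_filter.mp hm').1
      have hbig : h < ((f n : ℕ):ℝ)^2 := by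
        nlinarith
      rcases lt_trichotomy n m with c | c | c
      · have := hspace _ f1.pos n m f3 g3 c
        linarith
      · exact c
      · have := hspace _ f1.pos m n g3 f3 c
        linarith
  have hfl : 16 ≤ ⌊z⌋₊ := Nat.le_floor (by push_cast; linarith)
  have hsum : ((S.biUnion (fun q => I.filter (fun n => (q:ℤ)^2 ∣ n))).card : ℝ) ≤
      0.467 * h + 0.0232 * z := by
    have h1 : ((S.biUnion (fun q => I.filter (fun n => (q:ℤ)^2 ∣ n))).card : ℝ) ≤
        ∑ q ∈ S, ((I.filter (fun n => (q:ℤ)^2 ∣ n)).card : ℝ) := by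
      exact_mod_cast Finset.card_biUnion_le
    have h2 := Finset.sum_le_sum hsmall
    rw [Finset.sum_add_distrib, ← Finset.mul_sum, Finset.sum_const, nsmul_eq_mul, mul_one] at h2
    have h3 := prime_sq_sum ⌊z⌋₊ hfl
    have h4 := pi_bound z (by
      have hVz : V^4 ≤ z := by rw [hz]; nlinarith
      have := Real.log_le_log (by positivity) hVz
      rw [Real.log_pow, hVexp] at this
      push_cast at this
      linarith) hz0
    have h5 : h * ∑ q ∈ S, 1/(q:ℝ)^2 ≤ h * 0.467 := by gcongr
    linarith
  have htot := total p hVexp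
  have hc : (I.card : ℝ) ≤ ((S.biUnion (fun q => I.filter (fun n => (q:ℤ)^2 ∣ n))).card : ℝ) + I2.card := by
    exact_mod_cast (Finset.card_le_card hsub).trans (Finset.card_union_le _ _)
  rw [hzh] at hsum
  linarith

theorem squarefree_in_interval_large (x : ℝ) (hx : Real.exp 400 ≤ x) :
    ∃ n : ℕ, 0 < n ∧ x < (n : ℝ) ∧ (n : ℝ) ≤ x + 5 * x ^ ((1 : ℝ) / 5) * Real.log x ∧
      Squarefree n := by
  have hx0 : 0 < x := lt_of_lt_of_le (Real.exp_pos _) hx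
  set l := Real.log x with hl
  have hl400 : 400 ≤ l := by rw [hl, Real.le_log_iff_exp_le hx0]; exact hx
  set V := Real.exp (l / 20) with hV
  have hV4 : x ^ ((1:ℝ)/5) = V^4 := by
    rw [Real.rpow_def_of_pos hx0, ← hl, hV, ← Real.exp_nat_mul]
    congr 1; push_cast; ring
  have hV20 : x = (V^4)^5 := by
    rw [← pow_mul, hV, ← Real.exp_nat_mul]
    have : ((4*5:ℕ):ℝ) * (l/20) = l := by push_cast; ring
    rw [this, hl, Real.exp_log hx0]
  have he := Real.exp_one_gt_d9
  have h10 : 22000 ≤ Real.exp 10 := by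
    rw [show (10:ℝ) = ((10:ℕ):ℝ) * 1 by norm_num, Real.exp_nat_mul]
    calc (22000:ℝ) ≤ 2.7182818283^10 := by norm_num
      _ ≤ _ := by gcongr
  have h20 : 4.8e8 ≤ Real.exp 20 := by
    rw [show (20:ℝ) = ((20:ℕ):ℝ) * 1 by norm_num, Real.exp_nat_mul]
    calc (4.8e8:ℝ) ≤ 2.7182818283^20 := by norm_num
      _ ≤ _ := by gcongr
  have hpar : Par V l := by
    refine ⟨hl400, ?_, ?_⟩
    · refine h20.trans (Real.exp_le_exp.mpr (by linarith))
    · have e1 : V = (Real.exp (l/40))^2 := by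
        rw [hV, ← Real.exp_nat_mul]; congr 1; push_cast; ring
      have e2 : Real.exp (l/40) = Real.exp 10 * Real.exp (l/40 - 10) := by
        rw [← Real.exp_add]; congr 1; ring
      have e3 := Real.add_one_le_exp (l/40 - 10)
      have e4 : 55 * l ≤ Real.exp (l/40) := by
        rw [e2]
        calc 55 * l ≤ 22000 * (l/40 - 10 + 1) := by linarith
          _ ≤ _ := by gcongr; linarith
      rw [e1]
      calc 3000 * l^2 ≤ (55*l)^2 := by nlinarith
        _ ≤ _ := by gcongr
  have := main_contra hpar (by rw [hV, Real.log_exp])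
  rw [hV4]
  rw [← hV20] at this
  exact this
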